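/- Let M ⪯ N be models of a complete NIP first-order L-theory, with N sufficiently saturated. Let q(y) be a complete type over M. Then there exists a strict Morley sequence (b_n)_{n∈ℕ} in N for q(y). -/

import Mathlib

open FirstOrder FirstOrder.Language

universe u v w

namespace DistalPaper

variable (L : FirstOrder.Language.{u, v})

def SameTypeOver {N : Type w} [L.Structure N] (A : Set N) {γ : Type*} (b b' : γ → N) : Prop :=
  ∀ (p : ℕ) (φ : L.Formula (γ ⊕ Fin p)) (m : Fin p → N), (∀ i, m i ∈ A) →
    (φ.Realize (Sum.elim b m) ↔ φ.Realize (Sum.elim b' m))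

def IsIndiscernibleOver {N : Type w} [L.Structure N] (A : Set N) {I : Type*} [LinearOrder I]
    {γ : Type*} (b : I → γ → N) : Prop :=
  ∀ (m : ℕ) (i j : Fin m → I), StrictMono i → StrictMono j →
    SameTypeOver L A (fun q : Fin m × γ => b (i q.1) q.2) (fun q : Fin m × γ => b (j q.1) q.2)

def IsConsistentFamily {N : Type w} [L.Structure N] {α γ ι : Type*}
    (φ : L.Formula (α ⊕ γ)) (b : ι → γ → N) : Prop :=
  ∀ s : Finset ι, ∃ a : α → N, ∀ i ∈ s, φ.Realize (Sum.elim a (b i))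

structure ElemExt (N : Type w) [L.Structure N] where
  Carrier : Type max u v w
  [str : L.Structure Carrier]
  emb : N ↪ₑ[L] Carrier

attribute [instance] ElemExt.str

def Divides {N : Type w} [L.Structure N] (A : Set N) {α γ : Type*}
    (φ : L.Formula (α ⊕ γ)) (b : γ → N) : Prop :=
  ∃ (E : ElemExt L N) (c : ℕ → γ → E.Carrier),
    IsIndiscernibleOver L (⇑E.emb '' A) c ∧
    SameTypeOver L (⇑E.emb '' A) (c 0) (⇑E.emb ∘ b) ∧
    ¬ IsConsistentFamily L φ c

/-- The formula `φ(x, b)` forks over `A`: in some elementary extension it implies a finite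
disjunction of formulas, each of which divides over (the image of) `A`. -/
def Forks {N : Type w} [L.Structure N] (A : Set N) {α γ : Type*}
    (φ : L.Formula (α ⊕ γ)) (b : γ → N) : Prop :=
  ∃ (E : ElemExt L N) (k m : ℕ) (ψ : Fin k → L.Formula (α ⊕ Fin m))
    (c : Fin k → Fin m → E.Carrier),
    (∀ i, Divides L (⇑E.emb '' A) (ψ i) (c i)) ∧
    ∀ a : α → E.Carrier, φ.Realize (Sum.elim a (⇑E.emb ∘ b)) →
      ∃ i, (ψ i).Realize (Sum.elim a (c i))

/-- The complete type of the tuple `bs` over the parameter set `P` does not fork over `A`: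
no formula with parameters from `P` satisfied by `bs` forks over `A`. -/
def TypeDoesNotForkOver {N : Type w} [L.Structure N] (A P : Set N) {β : Type*}
    (bs : β → N) : Prop :=
  ∀ (p : ℕ) (φ : L.Formula (β ⊕ Fin p)) (c : Fin p → N), (∀ i, c i ∈ P) →
    φ.Realize (Sum.elim bs c) → ¬ Forks L A φ c

/-- `tp(a / A ∪ bs)` is strictly non-forking over `A`: it extends to a complete type `p`
over a monster model (an elementary extension `E` of `N`, realized by `a'` in a further
elementary extension `F`) such that `p` does not fork over `A` and, for the realization
`a'` of `p`, `tp(bs / A a')` does not fork over `A`. -/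
def StrictlyNonForkingOver {N : Type w} [L.Structure N] (A : Set N) {α β : Type*}
    (a : α → N) (bs : β → N) : Prop :=
  ∃ (E : ElemExt L N) (F : ElemExt L E.Carrier) (a' : α → F.Carrier),
    SameTypeOver L ((⇑F.emb ∘ ⇑E.emb) '' (A ∪ Set.range bs)) a' (⇑F.emb ∘ ⇑E.emb ∘ a) ∧
    TypeDoesNotForkOver L ((⇑F.emb ∘ ⇑E.emb) '' A) (Set.range ⇑F.emb) a' ∧
    TypeDoesNotForkOver L ((⇑F.emb ∘ ⇑E.emb) '' A)
      (((⇑F.emb ∘ ⇑E.emb) '' A) ∪ Set.range a') (⇑F.emb ∘ ⇑E.emb ∘ bs)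

/-- `b` is a strict Morley sequence over `A` for the complete type (over `A`) of the
tuple `q`: an `A`-indiscernible sequence of realizations of `tp(q/A)` such that each
`tp(b (n+1) / A, b 0, ..., b n)` is strictly non-forking over `A`. -/
def IsStrictMorleySequence {N : Type w} [L.Structure N] (A : Set N) {γ : Type*}
    (q : γ → N) (b : ℕ → γ → N) : Prop :=
  IsIndiscernibleOver L A b ∧
  (∀ n, SameTypeOver L A (b n) q) ∧
  ∀ n : ℕ, StrictlyNonForkingOver L A (b (n + 1)) (fun p : Fin (n + 1) × γ => b ↑p.1 p.2)

/-- `N` (equivalently, its complete theory) is NIP: no formula `φ(x, y)` has the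
independence property in any model of `Th(N)`. -/
def IsNIP (N : Type w) [L.Structure N] : Prop :=
  ∀ (nx ny : ℕ) (φ : L.Formula (Fin nx ⊕ Fin ny)),
    ¬ ∃ (K : Theory.ModelType.{u, v, max u v w} (L.completeTheory N))
        (a : ℕ → Fin nx → K) (bS : Set ℕ → Fin ny → K),
        ∀ (i : ℕ) (S : Set ℕ), φ.Realize (Sum.elim (a i) (bS S)) ↔ i ∈ S

/-- `N` is distal: it is NIP and, in every elementary extension, for every indiscernible
sequence `(b i)_{i ∈ ℤ}` and parameter set `A`, if the sequence with `b 0` omitted is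
indiscernible over `A`, then the whole sequence is indiscernible over `A`. -/
def IsDistal (N : Type w) [L.Structure N] : Prop :=
  IsNIP L N ∧
  ∀ (E : ElemExt L N) (m : ℕ) (b : ℤ → Fin m → E.Carrier) (A : Set E.Carrier),
    IsIndiscernibleOver L (∅ : Set E.Carrier) b →
    IsIndiscernibleOver L A (fun i : {i : ℤ // i ≠ 0} => b ↑i) →
    IsIndiscernibleOver L A b

/-- `N` is `κ`-saturated: every finitely satisfiable family of formulas in finitely many
free variables with parameters from a set of size `< κ` is realized in `N`. -/
def IsSaturated (κ : Cardinal.{w}) (N : Type w) [L.Structure N] : Prop :=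
  ∀ (A : Set N), Cardinal.mk A < κ →
    ∀ (n : ℕ) (ι : Type max u v w) (p : ι → ℕ) (φ : ∀ i, L.Formula (Fin n ⊕ Fin (p i)))
      (c : ∀ i, Fin (p i) → N), (∀ i j, c i j ∈ A) →
      (∀ s : Finset ι, ∃ a : Fin n → N, ∀ i ∈ s, (φ i).Realize (Sum.elim a (c i))) →
      ∃ a : Fin n → N, ∀ i, (φ i).Realize (Sum.elim a (c i))

/-- The complete type of `a` over the parameter set `P` (with `A ⊆ P`) extends to a
complete type over all of `N` which is `A`-invariant; the extension is encoded by a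
realization `a'` in an elementary extension of `N`. -/
def ExtendsToInvariantType {N : Type w} [L.Structure N] (A P : Set N) {α : Type*}
    (a : α → N) : Prop :=
  ∃ (E : ElemExt L N) (a' : α → E.Carrier),
    SameTypeOver L (⇑E.emb '' P) a' (⇑E.emb ∘ a) ∧
    ∀ (p : ℕ) (φ : L.Formula (α ⊕ Fin p)) (c c' : Fin p → N),
      SameTypeOver L A c c' →
      (φ.Realize (Sum.elim a' (⇑E.emb ∘ c)) ↔ φ.Realize (Sum.elim a' (⇑E.emb ∘ c')))

/-- Two sequences have the same Ehrenfeucht–Mostowski type over `A`: increasing tuples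
of the same length from either sequence have the same type over `A`. -/
def SameEMTypeOver {N : Type w} [L.Structure N] (A : Set N) {I J : Type*}
    [LinearOrder I] [LinearOrder J] {γ : Type*} (b : I → γ → N) (d : J → γ → N) : Prop :=
  ∀ (m : ℕ) (i : Fin m → I) (j : Fin m → J), StrictMono i → StrictMono j →
    SameTypeOver L A (fun q : Fin m × γ => b (i q.1) q.2) (fun q : Fin m × γ => d (j q.1) q.2)

/-- Insert the tuple `d` at position `0` into a sequence indexed by the nonzero integers. -/
def insertAtZero {X γ : Type*} (d : γ → X) (ds : {i : ℤ // i ≠ 0} → γ → X) : ℤ → γ → X :=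
  fun i => if h : i = 0 then d else ds ⟨i, h⟩


section Proof

open Filter

variable {L}
variable {N : Type w} [L.Structure N] (M : L.ElementarySubstructure N)

/-- Coercion of a tuple of `M` to a tuple of `N`. -/
def tup {κ : Type*} (m : κ → M) : κ → N := fun i => (m i : N)

variable {M}

lemma tup_mem {κ : Type*} (m : κ → M) (i : κ) : tup M m i ∈ (M : Set N) := (m i).2

lemma exists_point {κ : Type*} [Finite κ] {Y : Set (κ → N)} (hY : (M : Set N).Definable L Y)
    (hne : Y.Nonempty) : ∃ m : κ → M, tup M m ∈ Y := by
  obtain ⟨φ, rfl⟩ := Set.definable_iff_exists_formula_sum.1 hY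
  obtain ⟨y, hy⟩ := hne
  have h1 : (φ.iExs κ).Realize (M.subtype ∘ (fun a : ↥(M : Set N) => (⟨a.1, a.2⟩ : M))) :=
    Formula.realize_iExs.2 ⟨y, hy⟩
  rw [M.subtype.map_formula] at h1
  obtain ⟨m, hm⟩ := Formula.realize_iExs.1 h1
  refine ⟨m, ?_⟩
  rw [← M.subtype.map_formula] at hm
  simp only [Sum.comp_elim] at hm
  exact hm

lemma definable_section {α β : Type*} {X : Set (α ⊕ β → N)} (hX : (M : Set N).Definable L X)
    (m : β → M) : (M : Set N).Definable L {y : α → N | Sum.elim y (tup M m) ∈ X} := by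
  obtain ⟨φ, rfl⟩ := Set.definable_iff_exists_formula_sum.1 hX
  refine Set.definable_iff_exists_formula_sum.2
    ⟨φ.relabel (Sum.elim Sum.inl (Sum.elim Sum.inr (fun b => Sum.inl (m b)))), ?_⟩
  ext y
  simp only [Set.mem_ofPred_eq, Formula.realize_relabel]
  apply iff_of_eq
  congr 1
  ext i
  rcases i with i | i | i <;> rfl

lemma definable_reindex {α β : Type*} (f : α → β) {s : Set (α → N)}
    (h : (M : Set N).Definable L s) : (M : Set N).Definable L {g : β → N | g ∘ f ∈ s} :=
  h.preimage_comp f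

lemma definable_formula {α : Type*} (φ : L.Formula α) :
    (M : Set N).Definable L {g : α → N | φ.Realize g} :=
  (Set.empty_definable_iff.2 ⟨φ, rfl⟩).mono (Set.empty_subset _)

lemma definable_imp {α : Type*} {s t : Set (α → N)} (hs : (M : Set N).Definable L s)
    (ht : (M : Set N).Definable L t) : (M : Set N).Definable L {g | g ∈ s → g ∈ t} := by
  convert hs.compl.union ht using 1
  ext g
  simp [imp_iff_not_or]

lemma definable_eq {α : Type*} (i j : α) : (M : Set N).Definable L {g : α → N | g i = g j} := by
  convert definable_formula (M := M) ((Term.var i).equal (Term.var j) : L.Formula α) using 1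
  ext g
  simp

lemma definable_rel {ξ κ δ : Type*} [Finite ξ] [Finite κ] {X : Set (ξ ⊕ κ → N)}
    {W : Set (ξ ⊕ δ → N)} (hX : (M : Set N).Definable L X) (hW : (M : Set N).Definable L W) :
    (M : Set N).Definable L
      {y : δ → N | ∃ e : κ → N, ∀ x : ξ → N, Sum.elim x e ∈ X → Sum.elim x y ∈ W} := by
  have h1 := definable_reindex (M := M) (β := (δ ⊕ κ) ⊕ ξ)
    (Sum.elim Sum.inr (fun k => Sum.inl (Sum.inr k))) hX
  have h2 := definable_reindex (M := M) (β := (δ ⊕ κ) ⊕ ξ)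
    (Sum.elim Sum.inr (fun k => Sum.inl (Sum.inl k))) hW
  have h3 := ((definable_imp h1 h2).forall_of_finite).exists_of_finite
  convert h3 using 1
  ext y
  simp only [Set.mem_ofPred_eq]
  apply exists_congr
  intro e
  apply forall_congr'
  intro x
  apply iff_of_eq
  congr! 2 <;> (ext i; rcases i with i | i <;> rfl)

/-- lifting points along projections -/
lemma exists_lift {κ lam : Type*} [Finite κ] [Finite lam] {Y : Set (κ → N)}
    (hY : (M : Set N).Definable L Y) (g : lam → κ) (m : lam → M)
    (h : ∃ y ∈ Y, y ∘ g = tup M m) : ∃ n : κ → M, tup M n ∈ Y ∧ n ∘ g = m := by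
  have h1 := definable_reindex (M := M) (β := κ ⊕ lam) Sum.inl hY
  have h2 : (M : Set N).Definable L
      (⋂ i : lam, {z : κ ⊕ lam → N | z (Sum.inl (g i)) = z (Sum.inr i)}) :=
    Set.definable_iInter_of_finite fun i => definable_eq _ _
  have h3 := definable_section (h1.inter h2) m
  obtain ⟨y, hy, hyg⟩ := h
  obtain ⟨n, hn⟩ := exists_point h3 ⟨y, by
    constructor
    · exact hy
    · simp only [Set.mem_iInter, Set.mem_ofPred_eq, Sum.elim_inl, Sum.elim_inr]
      exact fun i => congrFun hyg i⟩
  refine ⟨n, hn.1, ?_⟩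
  have := hn.2
  simp only [Set.mem_iInter, Set.mem_ofPred_eq, Sum.elim_inl, Sum.elim_inr] at this
  ext i
  exact this i

/-- product of ultrafilters: outer `D`, inner `S`. -/
def uprod {Ω A : Type*} (D : Ultrafilter Ω) (S : Ultrafilter A) : Ultrafilter (Ω × A) :=
  D.bind fun d => S.map (Prod.mk d)

lemma ev_uprod {Ω A : Type*} (D : Ultrafilter Ω) (S : Ultrafilter A) (p : Ω × A → Prop) :
    (∀ᶠ z in (uprod D S : Filter (Ω × A)), p z) ↔
      ∀ᶠ d in (D : Filter Ω), ∀ᶠ a in (S : Filter A), p (d, a) := Iff.rfl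

/-- iterated power, the first `k` coordinates are meaningful. -/
def upow {A : Type*} (S : Ultrafilter A) : ℕ → Ultrafilter (ℕ → A)
  | 0 => S.map fun a _ => a
  | k + 1 => (uprod (upow S k) S).map fun z => Function.update z.1 k z.2

lemma ev_upow_succ {A : Type*} (S : Ultrafilter A) (k : ℕ) (p : (ℕ → A) → Prop) :
    (∀ᶠ z in (upow S (k + 1) : Filter (ℕ → A)), p z) ↔
      ∀ᶠ f in (upow S k : Filter (ℕ → A)), ∀ᶠ a in (S : Filter A), p (Function.update f k a) :=
  Iff.rfl

lemma ev_upow_apply {A : Type*} (S : Ultrafilter A) (p : A → Prop) (k j : ℕ) (hj : j < k)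
    (h : ∀ᶠ a in (S : Filter A), p a) : ∀ᶠ f in (upow S k : Filter (ℕ → A)), p (f j) := by
  induction k with
  | zero => omega
  | succ k ih =>
    rw [ev_upow_succ]
    rcases Nat.lt_succ_iff_lt_or_eq.1 hj with h1 | h1
    · filter_upwards [ih h1] with f hf
      refine Eventually.of_forall fun a => ?_
      rwa [Function.update_of_ne (by omega)]
    · subst h1
      refine Eventually.of_forall fun f => ?_
      simpa using h

/-- The invariance property of the Morley power: it depends only on the pushforwards. -/
lemma ev_upow_choice {A B : Type*} (S : Ultrafilter A) (r : Ultrafilter B) (k : ℕ)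
    (h : ℕ → A → B) (hh : ∀ j, S.map (h j) = r) :
    ∀ p : (ℕ → B) → Prop, (∀ f g, (∀ j < k, f j = g j) → (p f ↔ p g)) →
    ((∀ᶠ f in (upow S k : Filter (ℕ → A)), p fun j => h j (f j)) ↔
      ∀ᶠ f in (upow r k : Filter (ℕ → B)), p f) := by
  induction k with
  | zero =>
    intro p hp
    by_cases hc : ∃ f, p f
    · obtain ⟨f, hf⟩ := hc
      have : ∀ g, p g := fun g => (hp f g (by simp)).1 hf
      simp [this]
    · have : ∀ g, ¬ p g := fun g hg => hc ⟨g, hg⟩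
      simp [this, (upow S 0).neBot.ne, (upow r 0).neBot.ne]
  | succ k ih =>
    intro p hp
    rw [ev_upow_succ, ev_upow_succ]
    rw [← ih (fun f => ∀ᶠ a in (r : Filter B), p (Function.update f k a))]
    · apply eventually_congr
      refine Eventually.of_forall fun f => ?_
      rw [← hh k]
      change _ ↔ ∀ᶠ a in (S : Filter A), _
      apply eventually_congr
      refine Eventually.of_forall fun a => ?_
      apply hp
      intro j hj
      by_cases hjk : j = k
      · subst hjk; simp
      · simp [Function.update_of_ne hjk]
    · intro f g hfg
      apply eventually_congr
      refine Eventually.of_forall fun a => ?_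
      apply hp
      intro j hj
      by_cases hjk : j = k
      · subst hjk; simp
      · simp only [Function.update_of_ne hjk]
        exact hfg j (by omega)

variable (M) in
/-- The random set `Z` belongs to the heir filter of `q` over `M`. -/
def PP {ξ : Type} (q : ξ → N) {Ω : Type w} (U : Filter Ω) (Z : Ω → Set (ξ → N)) : Prop :=
  ∃ (κ : Type) (_ : Finite κ) (X : Set (ξ ⊕ κ → N)) (a : Ω → κ → M),
    (M : Set N).Definable L X ∧ (∀ m : κ → M, Sum.elim q (tup M m) ∈ X) ∧
    ∀ᶠ ω in U, ∀ x, Sum.elim x (tup M (a ω)) ∈ X → x ∈ Z ω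

section PPlemmas
variable {ξ : Type} {q : ξ → N} {Ω Ω' : Type w} {U : Filter Ω} {U' : Filter Ω'}
  {Z Z' : Ω → Set (ξ → N)}

lemma PP.mono (h : PP M q U Z) (hZ : ∀ᶠ ω in U, Z ω ⊆ Z' ω) : PP M q U Z' := by
  obtain ⟨κ, hκ, X, a, h1, h2, h3⟩ := h
  refine ⟨κ, hκ, X, a, h1, h2, ?_⟩
  filter_upwards [h3, hZ] with ω h4 h5 x hx using h5 (h4 x hx)

lemma PP.univ : PP M q U fun _ => Set.univ :=
  ⟨Empty, inferInstance, Set.univ, fun _ => Empty.elim, Set.definable_univ, fun _ => trivial,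
    Eventually.of_forall fun _ _ _ => trivial⟩

lemma PP.inter (h : PP M q U Z) (h' : PP M q U Z') : PP M q U fun ω => Z ω ∩ Z' ω := by
  obtain ⟨κ, hκ, X, a, h1, h2, h3⟩ := h
  obtain ⟨κ', hκ', X', a', h1', h2', h3'⟩ := h'
  have e1 : ∀ (x : ξ → N) (m : κ ⊕ κ' → M),
      (Sum.elim x (tup M m) ∘ Sum.map id Sum.inl : ξ ⊕ κ → N)
        = Sum.elim x (tup M (m ∘ Sum.inl)) := by
    intro x m; ext i; rcases i with i | i <;> rfl
  have e2 : ∀ (x : ξ → N) (m : κ ⊕ κ' → M),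
      (Sum.elim x (tup M m) ∘ Sum.map id Sum.inr : ξ ⊕ κ' → N)
        = Sum.elim x (tup M (m ∘ Sum.inr)) := by
    intro x m; ext i; rcases i with i | i <;> rfl
  refine ⟨κ ⊕ κ', inferInstance, _, fun ω => Sum.elim (a ω) (a' ω),
    (definable_reindex (β := ξ ⊕ (κ ⊕ κ')) (Sum.map id Sum.inl) h1).inter
    (definable_reindex (β := ξ ⊕ (κ ⊕ κ')) (Sum.map id Sum.inr) h1'), ?_, ?_⟩
  · intro m
    refine ⟨?_, ?_⟩
    · rw [Set.mem_ofPred_eq, e1]; exact h2 _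
    · rw [Set.mem_ofPred_eq, e2]; exact h2' _
  · filter_upwards [h3, h3'] with ω h4 h5 x hx
    obtain ⟨hx1, hx2⟩ := hx
    rw [Set.mem_ofPred_eq, e1] at hx1
    rw [Set.mem_ofPred_eq, e2] at hx2
    exact ⟨h4 x hx1, h5 x hx2⟩

lemma PP.forall_lt (k : ℕ) {Zs : ℕ → Ω → Set (ξ → N)} (h : ∀ j < k, PP M q U (Zs j)) :
    PP M q U fun ω => {x | ∀ j < k, x ∈ Zs j ω} := by
  induction k with
  | zero => exact PP.univ.mono (Eventually.of_forall fun _ _ _ => by simp)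
  | succ k ih =>
    refine ((ih fun j hj => h j (by omega)).inter (h k (by omega))).mono
      (Eventually.of_forall fun ω x hx j hj => ?_)
    rcases Nat.lt_succ_iff_lt_or_eq.1 hj with h1 | h1
    · exact hx.1 j h1
    · subst h1; exact hx.2

lemma PP.not_empty [NeBot U] : ¬ PP M q U fun _ => ∅ := by
  rintro ⟨κ, hκ, X, a, h1, h2, h3⟩
  obtain ⟨ω, hω⟩ := h3.exists
  exact hω q (h2 _)

lemma PP.comap (h : PP M q U Z) (f : Ω' → Ω) (hf : Tendsto f U' U) :
    PP M q U' fun ω => Z (f ω) := by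
  obtain ⟨κ, hκ, X, a, h1, h2, h3⟩ := h
  exact ⟨κ, hκ, X, a ∘ f, h1, h2, hf.eventually h3⟩

lemma PP.switch [Finite ξ] {δ : Type} [Finite δ] {W : Set (ξ ⊕ δ → N)}
    (hW : (M : Set N).Definable L W) (t : Ω → δ → M) (t' : Ω' → δ → M)
    (ht : ∀ Y : Set (δ → N), (M : Set N).Definable L Y → (∀ᶠ ω in U, tup M (t ω) ∈ Y) →
      ∀ᶠ ω in U', tup M (t' ω) ∈ Y)
    (h : PP M q U fun ω => {x | Sum.elim x (tup M (t ω)) ∈ W}) :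
    PP M q U' fun ω => {x | Sum.elim x (tup M (t' ω)) ∈ W} := by
  obtain ⟨κ, hκ, X, a, h1, h2, h3⟩ := h
  have hd := definable_rel h1 hW
  have e1 : ∀ (x : ξ → N) (m : δ → N), Sum.elim x m ∘ Sum.inr = m := fun x m => rfl
  refine ⟨δ, inferInstance, _, t', definable_imp (definable_reindex Sum.inr hd) hW, ?_, ?_⟩
  · intro m hm
    rw [Set.mem_ofPred_eq, e1] at hm
    have hd2 : (M : Set N).Definable L
        {e : κ → N | ∀ x : ξ → N, Sum.elim x e ∈ X → Sum.elim x (tup M m) ∈ W} := by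
      have g1 := definable_reindex (M := M) (β := κ ⊕ ξ) (Sum.elim Sum.inr Sum.inl) h1
      have g2 := definable_reindex (M := M) (β := κ ⊕ ξ) Sum.inr (definable_section hW m)
      convert (definable_imp g1 g2).forall_of_finite using 1
      ext e
      simp only [Set.mem_ofPred_eq]
      apply forall_congr'
      intro x
      apply iff_of_eq
      congr! 2
      ext i; rcases i with i | i <;> rfl
    obtain ⟨e, he⟩ := exists_point hd2 hm
    exact he q (h2 e)
  · have h4 := ht _ hd (h3.mono fun ω hω => ⟨_, hω⟩)
    filter_upwards [h4] with ω hω x hx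
    exact hx hω

end PPlemmas


/-- `R` and `R'` concentrate on the same type over `M`. -/
def TE {κ : Type*} (R R' : Ultrafilter (κ → M)) : Prop :=
  ∀ Y : Set (κ → N), (M : Set N).Definable L Y →
    (∀ᶠ a in (R : Filter (κ → M)), tup M a ∈ Y) → ∀ᶠ a in (R' : Filter (κ → M)), tup M a ∈ Y

lemma TE.symm {κ : Type*} {R R' : Ultrafilter (κ → M)} (h : TE R R') : TE R' R := by
  intro Y hY h1
  by_contra h2
  rw [← Ultrafilter.eventually_not] at h2
  have h3 := h Yᶜ hY.compl h2
  obtain ⟨a, ha, hb⟩ := (h1.and h3).exists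
  exact hb ha

lemma TE.trans {κ : Type*} {R R' R'' : Ultrafilter (κ → M)} (h : TE R R') (h' : TE R' R'') :
    TE R R'' := fun Y hY h1 => h' Y hY (h Y hY h1)

lemma TE.refl {κ : Type*} (R : Ultrafilter (κ → M)) : TE R R := fun _ _ h => h

/-- Some power of `S` makes the family `Φ` inconsistent. -/
def Good {ξ κ : Type*} (S : Ultrafilter (κ → M)) (Φ : Set (ξ ⊕ κ → N)) : Prop :=
  ∃ k : ℕ, ∀ᶠ f in (upow S k : Filter (ℕ → κ → M)),
    ∀ x, ¬ ∀ j < k, Sum.elim x (tup M (f j)) ∈ Φ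

lemma definable_exists_lt {α : Type*} (n : ℕ) (Φ : ℕ → Set (α → N))
    (h : ∀ i < n, (M : Set N).Definable L (Φ i)) :
    (M : Set N).Definable L {y | ∃ i < n, y ∈ Φ i} := by
  induction n with
  | zero => 
    convert Set.definable_empty (L := L) (A := (M : Set N)) (α := α) using 1
    ext y; simp
  | succ n ih =>
    convert (ih fun i hi => h i (by omega)).union (h n (by omega)) using 1
    ext y
    simp only [Set.mem_ofPred_eq, Set.mem_union]
    constructor
    · rintro ⟨i, hi, hy⟩
      rcases Nat.lt_succ_iff_lt_or_eq.1 hi with h1 | h1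
      · exact Or.inl ⟨i, h1, hy⟩
      · subst h1; exact Or.inr hy
    · rintro (⟨i, hi, hy⟩ | hy)
      · exact ⟨i, by omega, hy⟩
      · exact ⟨n, by omega, hy⟩

lemma switch_inner {ξ : Type} [Finite ξ] {q : ξ → N} {δ κ : Type} [Finite δ] [Finite κ]
    {Ω : Type w} (D : Ultrafilter Ω) (d : Ω → δ → M) {W : Set (ξ ⊕ δ → N)}
    (hW : (M : Set N).Definable L W) {V : Set (ξ ⊕ κ → N)} (hV : (M : Set N).Definable L V)
    {R S : Ultrafilter (κ → M)} (hRS : TE R S)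
    (h : PP M q (uprod D R : Filter (Ω × (κ → M))) fun z => {x | Sum.elim x (tup M (d z.1)) ∈ W ∨
      Sum.elim x (tup M z.2) ∈ V}) :
    PP M q (uprod D S : Filter (Ω × (κ → M))) fun z => {x | Sum.elim x (tup M (d z.1)) ∈ W ∨
      Sum.elim x (tup M z.2) ∈ V} := by
  have hU := (definable_reindex (β := ξ ⊕ (δ ⊕ κ)) (Sum.map id Sum.inl) hW).union
    (definable_reindex (β := ξ ⊕ (δ ⊕ κ)) (Sum.map id Sum.inr) hV)
  have key : ∀ (z : Ω × (κ → M)) (x : ξ → N),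
      (Sum.elim x (tup M (d z.1)) ∈ W ∨ Sum.elim x (tup M z.2) ∈ V) ↔
      Sum.elim x (tup M (Sum.elim (d z.1) z.2)) ∈
        ({g : ξ ⊕ (δ ⊕ κ) → N | g ∘ Sum.map id Sum.inl ∈ W} ∪ {g | g ∘ Sum.map id Sum.inr ∈ V}) := by
    intro z x
    apply iff_of_eq
    rw [Set.mem_union, Set.mem_ofPred_eq, Set.mem_ofPred_eq]
    congr! 2 <;> (ext i; rcases i with i | i <;> rfl)
  simp only [key] at h ⊢
  refine PP.switch hU (fun z : Ω × (κ → M) => Sum.elim (d z.1) z.2)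
    (fun z : Ω × (κ → M) => Sum.elim (d z.1) z.2) ?_ h
  intro Y hY h1
  rw [ev_uprod] at h1 ⊢
  filter_upwards [h1] with ω hω
  have hs := definable_section (definable_reindex (β := κ ⊕ δ) Sum.swap hY) (d ω)
  have key2 : ∀ y : κ → M, (tup M (Sum.elim (d ω) y) ∈ Y) ↔ tup M y ∈ 
      {y : κ → N | Sum.elim y (tup M (d ω)) ∈ {g : κ ⊕ δ → N | g ∘ Sum.swap ∈ Y}} := by
    intro y
    apply iff_of_eq
    simp only [Set.mem_ofPred_eq]
    congr! 1
    ext i; rcases i with i | i <;> rfl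
  simp only [key2] at hω ⊢
  exact hRS _ hs hω

lemma claim {ξ : Type} [Finite ξ] {q : ξ → N} {κ : Type} [Finite κ]
    (R0 : Ultrafilter (κ → M)) (Φ : ℕ → Set (ξ ⊕ κ → N)) (S : ℕ → Ultrafilter (κ → M))
    (n : ℕ) : (∀ i < n, (M : Set N).Definable L (Φ i)) → (∀ i < n, TE R0 (S i)) →
    (∀ i < n, Good (S i) (Φ i)) →
    ∀ (δ : Type) [Finite δ] (Ω : Type w) (D : Ultrafilter Ω) (d : Ω → δ → M)
      (W : Set (ξ ⊕ δ → N)), (M : Set N).Definable L W → ∀ R : Ultrafilter (κ → M), TE R R0 →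
    PP M q (uprod D R : Filter (Ω × (κ → M))) (fun z => {x | Sum.elim x (tup M (d z.1)) ∈ W ∨
      Sum.elim x (tup M z.2) ∈ {y | ∃ i < n, y ∈ Φ i}}) →
    PP M q (D : Filter Ω) fun ω => {x | Sum.elim x (tup M (d ω)) ∈ W} := by
  induction n with
  | zero =>
    intro _ _ _ δ _ Ω D d W hW R hR h
    refine PP.switch (U := (uprod D R : Filter (Ω × (κ → M)))) hW (fun z : Ω × (κ → M) => d z.1) d ?_
      (h.mono (Eventually.of_forall fun z x hx => ?_))
    · intro Y hY h1
      rw [ev_uprod] at h1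
      filter_upwards [h1] with ω hω
      exact hω.exists.choose_spec
    · rcases hx with hx | ⟨i, hi, _⟩
      · exact hx
      · omega
  | succ n ih =>
    intro hΦ hS hG δ _ Ω D d W hW R hR h
    have ih' := ih (fun i hi => hΦ i (by omega)) (fun i hi => hS i (by omega))
      (fun i hi => hG i (by omega))
    have hdef := definable_exists_lt n Φ (fun i hi => hΦ i (by omega))
    have h := switch_inner D d hW (definable_exists_lt (n + 1) Φ hΦ)
      (hR.trans (hS n (by omega))) h
    obtain ⟨k, hk⟩ := hG n (by omega)
    generalize hSn : S n = T at *
    have hT : TE T R0 := by rw [← hSn]; exact (hS n (by omega)).symm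
    have h2 : PP M q (uprod D (upow T k) : Filter (Ω × (ℕ → κ → M))) fun z => {x | Sum.elim x (tup M (d z.1)) ∈ W ∨
        ∃ j < k, Sum.elim x (tup M (z.2 j)) ∈ {y | ∃ i < n, y ∈ Φ i}} := by
      have h3 := PP.forall_lt (U := (uprod D (upow T k) : Filter (Ω × (ℕ → κ → M)))) k
        (fun j hj => h.comap (fun z : Ω × (ℕ → κ → M) => (z.1, z.2 j)) (by
          intro s hs
          change ∀ᶠ z in _, z ∈ s at hs
          rw [ev_uprod] at hs
          change ∀ᶠ z in (uprod D (upow T k) : Filter (Ω × (ℕ → κ → M))), (z.1, z.2 j) ∈ s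
          rw [ev_uprod]
          filter_upwards [hs] with ω hω
          exact ev_upow_apply T (fun a => (ω, a) ∈ s) k j hj hω))
      refine h3.mono ?_
      rw [ev_uprod]
      refine Eventually.of_forall fun ω => ?_
      filter_upwards [hk] with f hf x hx
      by_contra hcon
      simp only [Set.mem_ofPred_eq, not_or, not_exists, not_and] at hcon
      apply hf x
      intro j hj
      rcases hx j hj with h4 | ⟨i, hi, h4⟩
      · exact absurd h4 hcon.1
      · rcases Nat.lt_succ_iff_lt_or_eq.1 hi with h5 | h5
        · exact absurd h4 (hcon.2 j hj i h5)
        · subst h5; exact h4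
    clear hk h
    induction k with
    | zero =>
      refine PP.switch (U := (uprod D (upow T 0) : Filter (Ω × (ℕ → κ → M)))) hW (fun z : Ω × (ℕ → κ → M) => d z.1) d ?_
        (h2.mono (Eventually.of_forall fun z x hx => ?_))
      · intro Y hY h1
        rw [ev_uprod] at h1
        filter_upwards [h1] with ω hω
        exact hω.exists.choose_spec
      · rcases hx with hx | ⟨i, hi, _⟩
        · exact hx
        · omega
    | succ k ihk =>
      apply ihk
      have h3 := h2.comap (U' := (uprod (uprod D (upow T k)) T : Filter ((Ω × (ℕ → κ → M)) × (κ → M))))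
        (fun z : (Ω × (ℕ → κ → M)) × (κ → M) => (z.1.1, Function.update z.1.2 k z.2)) (fun s hs => hs)
      have hW'' : (M : Set N).Definable L
          ({g : ξ ⊕ (δ ⊕ (Fin k × κ)) → N | g ∘ Sum.map id Sum.inl ∈ W} ∪ 
          ⋃ j : Fin k, {g | g ∘ Sum.map id (fun c => Sum.inr (j, c)) ∈ {y | ∃ i < n, y ∈ Φ i}}) :=
        (definable_reindex _ hW).union
          (Set.definable_iUnion_of_finite fun j => definable_reindex _ hdef)
      have key : ∀ (z : Ω × (ℕ → κ → M)) (x : ξ → N),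
          (Sum.elim x (tup M (Sum.elim (d z.1) (fun p : Fin k × κ => z.2 p.1 p.2))) ∈
          ({g : ξ ⊕ (δ ⊕ (Fin k × κ)) → N | g ∘ Sum.map id Sum.inl ∈ W} ∪ 
          ⋃ j : Fin k, {g | g ∘ Sum.map id (fun c => Sum.inr (j, c)) ∈
            {y | ∃ i < n, y ∈ Φ i}})) ↔
          (Sum.elim x (tup M (d z.1)) ∈ W ∨
            ∃ j < k, Sum.elim x (tup M (z.2 j)) ∈ {y | ∃ i < n, y ∈ Φ i}) := by
        intro z x
        rw [Set.mem_union, Set.mem_iUnion]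
        apply or_congr
        · apply iff_of_eq
          rw [Set.mem_ofPred_eq]
          congr! 1
          ext i; rcases i with i | i <;> rfl
        · constructor
          · rintro ⟨j, hj⟩
            refine ⟨j, j.2, ?_⟩
            rw [Set.mem_ofPred_eq] at hj
            convert hj using 1
            ext i; rcases i with i | i <;> rfl
          · rintro ⟨j, hjk, hj⟩
            refine ⟨⟨j, hjk⟩, ?_⟩
            rw [Set.mem_ofPred_eq]
            convert hj using 1
            ext i; rcases i with i | i <;> rfl
      have h4 := ih' (δ ⊕ (Fin k × κ)) (Ω × (ℕ → κ → M)) (uprod D (upow T k))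
        (fun z => Sum.elim (d z.1) (fun p : Fin k × κ => z.2 p.1 p.2)) _ hW'' T hT
        (h3.mono (Eventually.of_forall fun z x hx => ?_))
      · exact h4.mono (Eventually.of_forall fun z x hx => (key z x).1 hx)
      · rcases hx with hx | ⟨j, hj, hx⟩
        · exact Or.inl ((key z.1 x).2 (Or.inl hx))
        · rcases Nat.lt_succ_iff_lt_or_eq.1 hj with h5 | h5
          · refine Or.inl ((key z.1 x).2 (Or.inr ⟨j, h5, ?_⟩))
            dsimp only at hx
            rwa [Function.update_of_ne (by omega)] at hx
          · subst h5
            right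
            dsimp only at hx
            rwa [Function.update_self] at hx


lemma exists_ulift_emb (K : Type w) [L.Structure K] :
    ∃ (F : Type max u v w) (_ : L.Structure F), Nonempty (K ↪ₑ[L] F) := by
  let : L.Structure (ULift.{max u v} K) := Equiv.ulift.symm.inducedStructure
  exact ⟨ULift.{max u v} K, inferInstance,
    ⟨(Equiv.inducedStructureEquiv (L := L) (Equiv.ulift.{max u v} (α := K)).symm).toElementaryEmbedding⟩⟩

lemma exists_ultra [Nonempty N] {I : Type w} (U : Ultrafilter I) :
    ∃ (F : Type max u v w) (_ : L.Structure F) (G : N ↪ₑ[L] F) (germ : (I → N) → F),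
      (∀ n, G n = germ fun _ => n) ∧
      ∀ (α : Type) (φ : L.Formula α) (t : α → I → N),
        φ.Realize (fun i => germ (t i)) ↔ ∀ᶠ x in (U : Filter I), φ.Realize (fun i => t i x) := by
  obtain ⟨F, hF, ⟨e⟩⟩ := exists_ulift_emb (L := L) ((U : Filter I).Product fun _ => N)
  let germ : (I → N) → F := fun x => e (Quotient.mk _ x)
  have key : ∀ (α : Type) (φ : L.Formula α) (t : α → I → N),
        φ.Realize (fun i => germ (t i)) ↔ ∀ᶠ x in (U : Filter I), φ.Realize (fun i => t i x) := by
    intro α φ t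
    have h1 := e.map_formula φ (fun i => Quotient.mk _ (t i))
    have h2 := Ultraproduct.realize_formula_cast (u := U) (M := fun _ => N) φ t
    exact h1.trans h2
  refine ⟨F, hF, ⟨fun n => germ fun _ => n, ?_⟩, germ, fun n => rfl, key⟩
  intro n φ x
  refine (key (Fin n) φ (fun i _ => x i)).trans ?_
  rw [eventually_const]

lemma definable_param {α : Type*} {X : Set (α → N)} (hX : (M : Set N).Definable L X) :
    ∃ (p : ℕ) (φ : L.Formula (α ⊕ Fin p)) (c : Fin p → M),
      ∀ y, y ∈ X ↔ φ.Realize (Sum.elim y (tup M c)) := by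
  obtain ⟨A0, hA0, hX⟩ := Set.definable_iff_finitely_definable.1 hX
  obtain ⟨φ, rfl⟩ := Set.definable_iff_exists_formula_sum.1 hX
  obtain ⟨p, ⟨e⟩⟩ := Finite.exists_equiv_fin (↥(A0 : Set N))
  refine ⟨p, φ.relabel (Sum.elim (fun a => Sum.inr (e a)) Sum.inl),
    fun i => ⟨(e.symm i).1, hA0 (e.symm i).2⟩, fun y => ?_⟩
  rw [Set.mem_ofPred_eq, Formula.realize_relabel]
  apply iff_of_eq
  congr 1
  ext i
  rcases i with i | i
  · simp [tup]
  · rfl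

lemma definable_of_formula {α β : Type*} (φ : L.Formula (α ⊕ β)) (c : β → M) :
    (M : Set N).Definable L {y : α → N | φ.Realize (Sum.elim y (tup M c))} :=
  definable_section (definable_formula φ) c

lemma nip_lemma (hNIP : IsNIP L N) {ξ γ : Type} [Finite ξ] [Finite γ] (q : ξ → N)
    {X : Set (ξ ⊕ γ → N)} (hX : (M : Set N).Definable L X) :
    ∃ k : ℕ, ¬ ∃ c : ℕ → γ → N, ∀ W : Set ℕ, ∃ x : ξ → N,
      ∀ j < k, (Sum.elim x (c j) ∈ X ↔ j ∈ W) := by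
  rcases isEmpty_or_nonempty N with hN | hN
  · refine ⟨1, ?_⟩
    rintro ⟨c, hc⟩
    obtain ⟨x, hx⟩ := hc Set.univ
    obtain ⟨y, hy⟩ := hc ∅
    have : IsEmpty ξ := ⟨fun i => hN.false (q i)⟩
    obtain rfl : x = y := Subsingleton.elim _ _
    have h1 := hx 0 (by omega)
    have h2 := hy 0 (by omega)
    simp only [Set.mem_univ, iff_true] at h1
    exact (h2.1 h1)
  by_contra hcon
  push Not at hcon
  choose c x hx using hcon
  obtain ⟨p, φ, m, hφ⟩ := definable_param hX
  obtain ⟨nx, ⟨e⟩⟩ := Finite.exists_equiv_fin (γ ⊕ Fin p)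
  obtain ⟨nξ, ⟨e'⟩⟩ := Finite.exists_equiv_fin ξ
  obtain ⟨F, hF, G, germ, -, hgerm⟩ := exists_ultra (L := L) (N := N)
    ((hyperfilter ℕ).map ULift.up.{w})
  have : Nonempty F := ⟨G (Classical.arbitrary N)⟩
  have : F ⊨ L.completeTheory N := (G.theory_model_iff _).1 inferInstance
  refine hNIP nx nξ (φ.relabel (Sum.elim (Sum.elim (fun i => Sum.inr (e' i))
    (fun i => Sum.inl (e (Sum.inl i)))) (fun i => Sum.inl (e (Sum.inr i)))))
    ⟨Theory.ModelType.of _ F,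
      fun i j => germ fun k => Sum.elim (c k.down i) (tup M m) (e.symm j),
      fun W j => germ fun k => x k.down W (e'.symm j), ?_⟩
  intro i W
  rw [Formula.realize_relabel]
  have h1 := hgerm _ φ (Sum.elim (Sum.elim (fun j k => x k.down W j)
    (fun j k => c k.down i j)) (fun j _ => tup M m j))
  have h2 : ∀ᶠ k in (hyperfilter ℕ : Filter ℕ), 
      (φ.Realize (fun j => Sum.elim (Sum.elim (fun j (k : ULift.{w} ℕ) => x k.down W j)
    (fun j k => c k.down i j)) (fun j _ => tup M m j) j (ULift.up k)) ↔ i ∈ W) := by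
    have : ∀ᶠ k in (hyperfilter ℕ : Filter ℕ), i < k :=
      (Nat.hyperfilter_le_atTop) (eventually_gt_atTop i)
    filter_upwards [this] with k hk
    rw [← hx k W i hk, hφ]
    apply iff_of_eq
    congr 1
    ext j
    rcases j with (j | j) | j <;> rfl
  refine Iff.trans (iff_of_eq ?_) (h1.trans ?_)
  · congr 1
    ext j
    rcases j with (j | j) | j <;> simp
  · have h3 := eventually_congr h2
    rw [eventually_const] at h3
    exact h3

lemma good_lemma (hNIP : IsNIP L N) {ξ γ κ : Type} [Finite ξ] [Finite γ] (q : ξ → N)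
    {X : Set (ξ ⊕ γ → N)} (hX : (M : Set N).Definable L X) (f g : γ → κ)
    (S : Ultrafilter (κ → M)) (hS : S.map (fun m => m ∘ f) = S.map (fun m => m ∘ g)) :
    Good S {y : ξ ⊕ κ → N | ¬ (y ∘ Sum.map id f ∈ X ↔ y ∘ Sum.map id g ∈ X)} := by
  obtain ⟨k, hk⟩ := nip_lemma hNIP q hX
  refine ⟨k, ?_⟩
  by_contra hcon
  rw [← Ultrafilter.eventually_not] at hcon
  have key : ∀ W : Set (Fin k), ∀ᶠ c in (upow (S.map (fun m => m ∘ f)) k : Filter (ℕ → γ → M)),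
      ∃ x : ξ → N, ∀ j : Fin k, (Sum.elim x (tup M (c j)) ∈ X ↔ j ∈ W) := by
    intro W
    have h1 : ∀ᶠ F in (upow S k : Filter (ℕ → κ → M)), ∃ e : Fin k → Bool, ∃ x : ξ → N,
        ∀ j : Fin k, (Sum.elim x (tup M (F j ∘ (if e j then f else g))) ∈ X ↔ j ∈ W) := by
      filter_upwards [hcon] with F hF
      push Not at hF
      obtain ⟨x, hx⟩ := hF
      classical
      refine ⟨fun j => decide (Sum.elim x (tup M (F j ∘ f)) ∈ X ↔ j ∈ W), x, fun j => ?_⟩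
      have h2 := hx j j.2
      have e1 : ∀ h : γ → κ, (Sum.elim x (tup M (F j)) ∘ Sum.map id h : ξ ⊕ γ → N)
          = Sum.elim x (tup M (F j ∘ h)) := by
        intro h; ext i; rcases i with i | i <;> rfl
      rw [e1, e1] at h2
      by_cases h3 : (Sum.elim x (tup M (F j ∘ f)) ∈ X ↔ j ∈ W)
      · simp [h3]
      · simp only [h3, decide_false]
        simp only [Bool.false_eq_true, if_false]
        tauto
    have h2 : ∃ e : Fin k → Bool, ∀ᶠ F in (upow S k : Filter (ℕ → κ → M)), ∃ x : ξ → N,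
        ∀ j : Fin k, (Sum.elim x (tup M (F j ∘ (if e j then f else g))) ∈ X ↔ j ∈ W) := by
      by_contra h3
      rw [not_exists] at h3
      have h4 : ∀ e : Fin k → Bool, ∀ᶠ F in (upow S k : Filter (ℕ → κ → M)), ¬ ∃ x : ξ → N,
        ∀ j : Fin k, (Sum.elim x (tup M (F j ∘ (if e j then f else g))) ∈ X ↔ j ∈ W) := by
        intro e
        rw [Ultrafilter.eventually_not]
        intro h5
        exact (h3 e) h5
      rw [← eventually_all] at h4
      obtain ⟨F, hF, e, he⟩ := (h4.and h1).exists
      exact hF e he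
    obtain ⟨e, he⟩ := h2
    have h3 := (ev_upow_choice S (S.map (fun m => m ∘ f)) k
      (fun j m => m ∘ (if hj : j < k then (if e ⟨j, hj⟩ then f else g) else f)) (by
        intro j
        by_cases hj : j < k
        · by_cases h' : e ⟨j, hj⟩
          · simp [hj, h']
          · simp [hj, h', hS]
        · simp [hj]) (fun c => ∃ x : ξ → N, ∀ j : Fin k, 
            (Sum.elim x (tup M (c j)) ∈ X ↔ j ∈ W)) (by
        intro c c' hc
        apply exists_congr
        intro x
        apply forall_congr'
        intro j
        rw [hc j j.2])).1
    apply h3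
    filter_upwards [he] with F hF
    obtain ⟨x, hx⟩ := hF
    refine ⟨x, fun j => ?_⟩
    rw [← hx j]
    simp
  rw [← eventually_all] at key
  obtain ⟨c, hc⟩ := key.exists
  refine hk ⟨fun j => tup M (c j), fun W => ?_⟩
  obtain ⟨x, hx⟩ := hc {j | (j : ℕ) ∈ W}
  exact ⟨x, fun j hj => hx ⟨j, hj⟩⟩


/-- The filter of `M`-definable sets containing the tuple `a`, traced on `M`. -/
lemma exists_law {κ : Type} [Finite κ] (a : κ → N) : ∃ R : Ultrafilter (κ → M),
    ∀ Y : Set (κ → N), (M : Set N).Definable L Y → a ∈ Y →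
      ∀ᶠ m in (R : Filter (κ → M)), tup M m ∈ Y := by
  let F : Filter (κ → M) :=
    { sets := {A | ∃ Y : Set (κ → N), (M : Set N).Definable L Y ∧ a ∈ Y ∧ ∀ m, tup M m ∈ Y → m ∈ A}
      univ_sets := ⟨Set.univ, Set.definable_univ, trivial, fun _ _ => trivial⟩
      sets_of_superset := by
        rintro A B ⟨Y, h1, h2, h3⟩ hAB
        exact ⟨Y, h1, h2, fun m hm => hAB (h3 m hm)⟩
      inter_sets := by
        rintro A B ⟨Y, h1, h2, h3⟩ ⟨Y', h1', h2', h3'⟩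
        exact ⟨Y ∩ Y', h1.inter h1', ⟨h2, h2'⟩, fun m hm => ⟨h3 m hm.1, h3' m hm.2⟩⟩ }
  have hF : NeBot F := by
    rw [neBot_iff, ne_eq, ← empty_mem_iff_bot]
    rintro ⟨Y, h1, h2, h3⟩
    obtain ⟨m, hm⟩ := exists_point h1 ⟨a, h2⟩
    exact h3 m hm
  refine ⟨Ultrafilter.of F, fun Y hY ha => ?_⟩
  exact Ultrafilter.of_le F ⟨Y, hY, ha, fun m hm => hm⟩

lemma exists_ext {κ lam : Type} [Finite κ] [Finite lam] (R : Ultrafilter (κ → M))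
    (r : Ultrafilter (lam → M)) (g : lam → κ)
    (h : ∀ Y : Set (lam → N), (M : Set N).Definable L Y →
      (∀ᶠ m in (R : Filter (κ → M)), tup M (m ∘ g) ∈ Y) → 
      ∀ᶠ m in (r : Filter (lam → M)), tup M m ∈ Y) :
    ∃ R' : Ultrafilter (κ → M), TE R R' ∧ R'.map (fun m => m ∘ g) = r := by
  let F : Filter (κ → M) :=
    { sets := {A | ∃ Y : Set (κ → N), (M : Set N).Definable L Y ∧
        (∀ᶠ m in (R : Filter (κ → M)), tup M m ∈ Y) ∧ ∀ m, tup M m ∈ Y → m ∈ A}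
      univ_sets := ⟨Set.univ, Set.definable_univ, by simp, fun _ _ => trivial⟩
      sets_of_superset := by
        rintro A B ⟨Y, h1, h2, h3⟩ hAB
        exact ⟨Y, h1, h2, fun m hm => hAB (h3 m hm)⟩
      inter_sets := by
        rintro A B ⟨Y, h1, h2, h3⟩ ⟨Y', h1', h2', h3'⟩
        exact ⟨Y ∩ Y', h1.inter h1', h2.and h2', fun m hm => ⟨h3 m hm.1, h3' m hm.2⟩⟩ }
  have hF : NeBot (F ⊓ Filter.comap (fun m => m ∘ g) (r : Filter (lam → M))) := by
    rw [inf_neBot_iff]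
    rintro A ⟨Y, h1, h2, h3⟩ B ⟨C, hC, hB⟩
    have h4 := h1.image_comp g
    have h5 := h _ h4 (h2.mono fun m hm => ⟨_, hm, rfl⟩)
    obtain ⟨m, ⟨y, hy, hym⟩, hmC⟩ := (h5.and hC).exists
    obtain ⟨n, hn, hng⟩ := exists_lift h1 g m ⟨y, hy, hym⟩
    refine ⟨n, h3 n hn, hB ?_⟩
    rw [Set.mem_preimage, hng]
    exact hmC
  refine ⟨Ultrafilter.of (F ⊓ Filter.comap (fun m => m ∘ g) (r : Filter (lam → M))), ?_, ?_⟩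
  · intro Y hY h1
    exact (Ultrafilter.of_le _).trans inf_le_left ⟨Y, hY, h1, fun m hm => hm⟩
  · apply Ultrafilter.eq_of_le
    rw [Ultrafilter.coe_map]
    exact map_le_iff_le_comap.2 ((Ultrafilter.of_le _).trans inf_le_right)

lemma claim_fin {ξ : Type} [Finite ξ] {q : ξ → N} {κ : Type} [Finite κ] {J : Type} [Finite J]
    (R0 : Ultrafilter (κ → M)) (Φ : J → Set (ξ ⊕ κ → N)) (S : J → Ultrafilter (κ → M))
    (hΦ : ∀ j, (M : Set N).Definable L (Φ j)) (hS : ∀ j, TE R0 (S j))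
    (hG : ∀ j, Good (S j) (Φ j)) :
    ¬ PP M q (R0 : Filter (κ → M)) (fun m => {x | ∃ j, Sum.elim x (tup M m) ∈ Φ j}) := by
  intro h
  obtain ⟨n, ⟨e⟩⟩ := Finite.exists_equiv_fin J
  have h1 := claim (q := q) R0 (fun i => if hi : i < n then Φ (e.symm ⟨i, hi⟩) else ∅)
    (fun i => if hi : i < n then S (e.symm ⟨i, hi⟩) else R0) n
    (fun i hi => by simp [hi, hΦ]) (fun i hi => by simp [hi, hS]) (fun i hi => by simp [hi, hG])
    Empty PUnit.{w+1} (pure PUnit.unit) (fun _ => Empty.elim) ∅ Set.definable_empty R0 (TE.refl _)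
    ((h.comap (U' := (uprod (pure PUnit.unit : Ultrafilter PUnit.{w+1}) R0 :
      Filter (PUnit.{w+1} × (κ → M)))) Prod.snd ?_).mono (Eventually.of_forall ?_))
  · have h2 : PP M q ((pure PUnit.unit : Ultrafilter PUnit.{w+1}) : Filter PUnit.{w+1})
        (fun _ => ∅) := h1.mono (Eventually.of_forall fun ω x hx => hx)
    exact PP.not_empty h2
  · intro s hs
    change ∀ᶠ z in (uprod (pure PUnit.unit : Ultrafilter PUnit.{w+1}) R0 :
      Filter (PUnit.{w+1} × (κ → M))), z.2 ∈ s
    exact (ev_uprod _ R0 (fun z => z.2 ∈ s)).2 (Eventually.of_forall fun _ => hs)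
  · rintro z x ⟨j, hj⟩
    right
    refine ⟨e j, (e j).2, ?_⟩
    simpa using hj

/-- same type over `M`, in terms of definable sets. -/
def Eqv (M : L.ElementarySubstructure N) {γ : Type*} (c c' : γ → N) : Prop :=
  ∀ Y : Set (γ → N), (M : Set N).Definable L Y → c ∈ Y → c' ∈ Y

lemma definable_iff {α : Type*} {s t : Set (α → N)} (hs : (M : Set N).Definable L s)
    (ht : (M : Set N).Definable L t) : (M : Set N).Definable L {g | g ∈ s ↔ g ∈ t} := by
  convert (definable_imp hs ht).inter (definable_imp ht hs) using 1
  ext g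
  exact iff_def

lemma definable_not_iff {α : Type*} {s t : Set (α → N)} (hs : (M : Set N).Definable L s)
    (ht : (M : Set N).Definable L t) : (M : Set N).Definable L {g | ¬ (g ∈ s ↔ g ∈ t)} :=
  (definable_iff hs ht).compl

/-- The law of a pair, with the outer variable on the right. -/
def pairLaw {κ : Type} (R R' : Ultrafilter (κ → M)) : Ultrafilter (κ ⊕ κ → M) :=
  (uprod R R').map fun z => Sum.elim z.2 z.1

lemma pairLaw_inr {κ : Type} (R R' : Ultrafilter (κ → M)) :
    (pairLaw R R').map (fun m => m ∘ Sum.inr) = R := by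
  ext s
  change (∀ᶠ a in (R : Filter (κ → M)), ∀ᶠ b in (R' : Filter (κ → M)), a ∈ s) ↔ s ∈ R
  simp only [eventually_const]
  rfl

lemma pairLaw_inl {κ : Type} (R R' : Ultrafilter (κ → M)) :
    (pairLaw R R').map (fun m => m ∘ Sum.inl) = R' := by
  ext s
  change (∀ᶠ a in (R : Filter (κ → M)), ∀ᶠ b in (R' : Filter (κ → M)), b ∈ s) ↔ s ∈ R'
  simp only [eventually_const]
  rfl

lemma pairLaw_TE {κ : Type} (R : Ultrafilter (κ → M)) {R' R'' : Ultrafilter (κ → M)}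
    (h : TE R' R'') : TE (pairLaw R R') (pairLaw R R'') := by
  intro Y hY h1
  change ∀ᶠ a in (R : Filter (κ → M)), ∀ᶠ b in (R' : Filter (κ → M)), tup M (Sum.elim b a) ∈ Y at h1
  change ∀ᶠ a in (R : Filter (κ → M)), ∀ᶠ b in (R'' : Filter (κ → M)), tup M (Sum.elim b a) ∈ Y
  have e : ∀ a b : κ → M, tup M (Sum.elim b a) = Sum.elim (tup M b) (tup M a) := by
    intro a b; ext i; rcases i with i | i <;> rfl
  filter_upwards [h1] with a ha
  simp only [e] at ha ⊢
  exact h _ (definable_section hY a) ha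

lemma elim_comp_map {ξ κ γ : Type*} (x : ξ → N) (a : κ → N) (f : γ → κ) :
    (Sum.elim x a ∘ Sum.map id f : ξ ⊕ γ → N) = Sum.elim x (a ∘ f) := by
  ext i; rcases i with i | i <;> rfl

theorem exists_type (hNIP : IsNIP L N) {ξ : Type} [Finite ξ] (q : ξ → N) :
    ∃ p : Ultrafilter (ξ → N),
      (∀ (κ : Type) [Finite κ] (X : Set (ξ ⊕ κ → N)), (M : Set N).Definable L X →
        (∀ m : κ → M, Sum.elim q (tup M m) ∈ X) → ∀ d : κ → N,
        ∀ᶠ x in (p : Filter (ξ → N)), Sum.elim x d ∈ X) ∧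
      (∀ (γ : Type) [Finite γ] (X : Set (ξ ⊕ γ → N)), (M : Set N).Definable L X →
        ∀ c c' : γ → N, Eqv M c c' →
        ∀ᶠ x in (p : Filter (ξ → N)), (Sum.elim x c ∈ X ↔ Sum.elim x c' ∈ X)) := by
  let 𝒢 : Set (Set (ξ → N)) := {A | ∃ (κ : Type) (_ : Finite κ) (X : Set (ξ ⊕ κ → N)) (d : κ → N)
      (γ : Type) (_ : Finite γ) (X' : Set (ξ ⊕ γ → N)) (c c' : γ → N),
      (M : Set N).Definable L X ∧ (∀ m : κ → M, Sum.elim q (tup M m) ∈ X) ∧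
      (M : Set N).Definable L X' ∧ Eqv M c c' ∧
      ∀ x, (Sum.elim x d ∈ X ∧ (Sum.elim x c ∈ X' ↔ Sum.elim x c' ∈ X')) → x ∈ A}
  obtain ⟨p, hp⟩ := Ultrafilter.exists_ultrafilter_of_finite_inter_nonempty 𝒢 (by
    intro T hT
    have hT' : ∀ i : Fin T.card, ((T.equivFin.symm i : T) : Set (ξ → N)) ∈ 𝒢 := 
      fun i => hT (T.equivFin.symm i).2
    choose κ hκ X d γ hγ X' c c' hX hq hX' hcc hsub using hT'
    let K := Σ i : Fin T.card, (κ i ⊕ (γ i ⊕ γ i))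
    let a : K → N := fun z => Sum.elim (d z.1) (Sum.elim (c z.1) (c' z.1)) z.2
    let dd : ∀ i, κ i → K := fun i z => ⟨i, Sum.inl z⟩
    let ff : ∀ i, γ i → K := fun i z => ⟨i, Sum.inr (Sum.inl z)⟩
    let gg : ∀ i, γ i → K := fun i z => ⟨i, Sum.inr (Sum.inr z)⟩
    obtain ⟨R, hR⟩ := exists_law (M := M) a
    by_contra hemp
    rw [Set.not_nonempty_iff_eq_empty] at hemp
    have hbad : ∀ x : ξ → N, ∃ i, ¬ (Sum.elim x (a ∘ dd i) ∈ X i ∧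
        (Sum.elim x (a ∘ ff i) ∈ X' i ↔ Sum.elim x (a ∘ gg i) ∈ X' i)) := by
      intro x
      by_contra h
      push Not at h
      have : x ∈ ⋂₀ (↑T : Set (Set (ξ → N))) := by
        rintro A hA
        have h2 := hsub (T.equivFin ⟨A, hA⟩) x ⟨(h _).1, (h _).2⟩
        simpa using h2
      rw [hemp] at this
      exact this
    have hdef : (M : Set N).Definable L {y : K → N | ∀ x : ξ → N, ∃ i,
        ¬ (Sum.elim x (y ∘ dd i) ∈ X i ∧
        (Sum.elim x (y ∘ ff i) ∈ X' i ↔ Sum.elim x (y ∘ gg i) ∈ X' i))} := by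
      have h1 : ∀ i, (M : Set N).Definable L ({y : K ⊕ ξ → N | 
          y ∘ (Sum.elim Sum.inr (fun z => Sum.inl (dd i z))) ∈ X i} ∩ 
          {y : K ⊕ ξ → N | (y ∈ {y | y ∘ (Sum.elim Sum.inr (fun z => Sum.inl (ff i z))) ∈ X' i} ↔
            y ∈ {y : K ⊕ ξ → N | y ∘ (Sum.elim Sum.inr (fun z => Sum.inl (gg i z))) ∈ X' i})}) :=
        fun i => (definable_reindex _ (hX i)).inter
          (definable_iff (definable_reindex _ (hX' i)) (definable_reindex _ (hX' i)))
      have h2 := (Set.definable_iUnion_of_finite fun i => (h1 i).compl).forall_of_finite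
      convert h2 using 1
      ext y
      simp only [Set.mem_ofPred_eq, Set.mem_iUnion, Set.mem_compl_iff, Set.mem_inter_iff]
      apply forall_congr'
      intro x
      apply exists_congr
      intro i
      have e1 : ∀ (γ : Type) (f : γ → K), (Sum.elim y x ∘ Sum.elim Sum.inr (fun z => Sum.inl (f z)))
          = Sum.elim x (y ∘ f) := by
        intro γ f; ext i; rcases i with i | i <;> rfl
      rw [e1, e1, e1]
    have hR1 := hR _ hdef hbad
    have hext : ∀ j : Fin T.card × Bool, ∃ R' : Ultrafilter (K → M), TE R R' ∧
        R'.map (fun m => m ∘ (if j.2 then ff j.1 else gg j.1)) = R.map (fun m => m ∘ ff j.1) := by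
      rintro ⟨i, b⟩
      cases b
      · apply exists_ext
        intro Y hY h1
        by_contra h2
        rw [← Ultrafilter.eventually_not] at h2
        change ∀ᶠ m in (R : Filter (K → M)), ¬ tup M (m ∘ ff i) ∈ Y at h2
        have h3 : c i ∉ Y := by
          intro h4
          have := hR _ (definable_reindex (ff i) hY) h4
          obtain ⟨m, hm1, hm2⟩ := (h2.and this).exists
          exact hm1 hm2
        have h4 : c' i ∉ Y := hcc i Yᶜ hY.compl h3
        have h5 := hR _ (definable_reindex (gg i) hY.compl) h4
        obtain ⟨m, hm1, hm2⟩ := (h1.and h5).exists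
        exact hm2 hm1
      · exact ⟨R, TE.refl _, by simp⟩
    choose R' hR'1 hR'2 using hext
    refine claim_fin (q := q) (pairLaw R R)
      (fun j : Fin T.card × Bool => {y : ξ ⊕ (K ⊕ K) → N | ¬
        (y ∘ Sum.map id (fun z => Sum.inl ((if j.2 then ff j.1 else gg j.1) z)) ∈ X' j.1 ↔
          y ∘ Sum.map id (fun z => Sum.inr (ff j.1 z)) ∈ X' j.1)})
      (fun j => pairLaw R (R' j)) ?_ ?_ ?_ ?_
    · intro j
      exact definable_not_iff (definable_reindex _ (hX' j.1)) (definable_reindex _ (hX' j.1))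
    · intro j
      exact pairLaw_TE R (hR'1 j)
    · intro j
      apply good_lemma hNIP q (hX' j.1)
      have h1 := congrArg (Ultrafilter.map (fun m => m ∘ (if j.2 then ff j.1 else gg j.1)))
        (pairLaw_inl R (R' j))
      have h2 := congrArg (Ultrafilter.map (fun m => m ∘ ff j.1)) (pairLaw_inr R (R' j))
      rw [hR'2] at h1
      rw [← h1] at h2
      exact h2.symm
    · refine ⟨K, inferInstance, ⋂ i, {y | y ∘ Sum.map id (dd i) ∈ X i}, fun m => m ∘ Sum.inl,
        Set.definable_iInter_of_finite fun i => definable_reindex _ (hX i), ?_, ?_⟩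
      · intro m
        rw [Set.mem_iInter]
        intro i
        rw [Set.mem_ofPred_eq, elim_comp_map]
        exact hq i _
      · have h1 : ∀ᶠ m in (pairLaw R R : Filter (K ⊕ K → M)), tup M (m ∘ Sum.inl) ∈
            {y : K → N | ∀ x : ξ → N, ∃ i, ¬ (Sum.elim x (y ∘ dd i) ∈ X i ∧
              (Sum.elim x (y ∘ ff i) ∈ X' i ↔ Sum.elim x (y ∘ gg i) ∈ X' i))} := by
          have := pairLaw_inl R R
          rw [← this] at hR1
          exact hR1
        filter_upwards [h1] with m hm x hx
        obtain ⟨i, hi⟩ := hm x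
        rw [Set.mem_iInter] at hx
        have h2 := hx i
        rw [Set.mem_ofPred_eq, elim_comp_map] at h2
        rw [not_and] at hi
        have h3 := hi h2
        by_contra hcon
        rw [not_exists] at hcon
        have h4 := hcon (i, true)
        have h5 := hcon (i, false)
        rw [not_not, elim_comp_map, elim_comp_map] at h4 h5
        exact h3 (h4.trans h5.symm))
  refine ⟨p, ?_, ?_⟩
  · intro κ _ X hX hq d
    exact hp ⟨κ, inferInstance, X, d, Empty, inferInstance, Set.univ, Empty.elim, Empty.elim,
      hX, hq, Set.definable_univ, fun _ _ h => h, fun x hx => hx.1⟩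
  · intro γ _ X hX c c' hcc
    exact hp ⟨Empty, inferInstance, Set.univ, Empty.elim, γ, inferInstance, X, c, c',
      Set.definable_univ, fun _ => trivial, hX, hcc, fun x hx => hx.2⟩


lemma Eqv.symm {γ : Type*} {c c' : γ → N} (h : Eqv M c c') : Eqv M c' c := by
  intro Y hY h1
  by_contra h2
  exact h Yᶜ hY.compl h2 h1

lemma Eqv.sameType {γ : Type*} {c c' : γ → N} (h : Eqv M c c') :
    SameTypeOver L (M : Set N) c c' := by
  intro p φ m hm
  have h1 := definable_of_formula (M := M) φ (fun i => ⟨m i, hm i⟩)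
  exact ⟨fun h2 => h _ h1 h2, fun h2 => h.symm _ h1 h2⟩

lemma Eqv.of_sameType {γ : Type*} {c c' : γ → N} (h : SameTypeOver L (M : Set N) c c') :
    Eqv M c c' := by
  intro Y hY h1
  obtain ⟨p, φ, m, hφ⟩ := definable_param hY
  rw [hφ] at h1 ⊢
  exact (h p φ (tup M m) (tup_mem m)).1 h1

lemma finite_case (hM : Finite M) (x : N) : x ∈ (M : Set N) := by
  by_contra hx
  have h1 : ∀ m : M, (M : Set N).Definable L {y : Unit → N | y () = m} := by
    intro m
    exact definable_section (definable_eq (Sum.inl ()) (Sum.inr ())) (fun _ : Unit => m)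
  have h2 := (Set.definable_iUnion_of_finite h1).compl
  obtain ⟨m, hm⟩ := exists_point h2 ⟨fun _ => x, by
    simp only [Set.mem_compl_iff, Set.mem_iUnion, not_exists]
    intro m hm
    apply hx
    change x = m at hm
    rw [hm]
    exact m.2⟩
  apply hm
  rw [Set.mem_iUnion]
  exact ⟨m (), rfl⟩

lemma card_params {β : Type} [Finite β] (a : β → N) :
    Cardinal.mk ↥((M : Set N) ∪ Set.range a) < Order.succ (Cardinal.mk M) := by
  rw [Order.lt_succ_iff]
  rcases finite_or_infinite M with hM | hM
  · have : (M : Set N) ∪ Set.range a ⊆ (M : Set N) := fun x _ => finite_case hM x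
    exact Cardinal.mk_le_mk_of_subset this
  · refine (Cardinal.mk_union_le _ _).trans ?_
    refine Cardinal.add_le_of_le (Cardinal.aleph0_le_mk M) le_rfl ?_
    have : Finite (Set.range a) := Set.finite_range a
    exact (Cardinal.lt_aleph0_of_finite _).le.trans (Cardinal.aleph0_le_mk M)

lemma sat_fin (hsat : IsSaturated L (Order.succ (Cardinal.mk M)) N) {n : ℕ} {β : Type} [Finite β]
    (U : Ultrafilter (Fin n → N)) (a : β → N) :
    ∃ b : Fin n → N, ∀ X : Set (Fin n ⊕ β → N), (M : Set N).Definable L X →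
      (∀ᶠ x in (U : Filter (Fin n → N)), Sum.elim x a ∈ X) → Sum.elim b a ∈ X := by
  let A : Set N := (M : Set N) ∪ Set.range a
  let ι : Type max u v w := {t : Σ p : ℕ, L.Formula (Fin n ⊕ Fin p) × (Fin p → A) //
    ∀ᶠ x in (U : Filter (Fin n → N)), t.2.1.Realize (Sum.elim x (fun i => (t.2.2 i : N)))}
  obtain ⟨b, hb⟩ := hsat A (card_params a) n ι (fun t => t.1.1) (fun t => t.1.2.1)
    (fun t i => (t.1.2.2 i : N)) (fun t i => (t.1.2.2 i).2) (by
      intro s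
      have : ∀ᶠ x in (U : Filter (Fin n → N)), ∀ t ∈ s, 
          t.1.2.1.Realize (Sum.elim x (fun i => (t.1.2.2 i : N))) :=
        (eventually_all_finset s).2 fun t _ => t.2
      exact this.exists)
  refine ⟨b, fun X hX hU => ?_⟩
  obtain ⟨p, φ, m, hφ⟩ := definable_param hX
  obtain ⟨p', ⟨e⟩⟩ := Finite.exists_equiv_fin (β ⊕ Fin p)
  let c : Fin p' → A := fun i => Sum.elim (fun j => (⟨a j, Or.inr ⟨j, rfl⟩⟩ : A))
    (fun j => ⟨tup M m j, Or.inl (tup_mem m j)⟩) (e.symm i)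
  let ψ : L.Formula (Fin n ⊕ Fin p') := φ.relabel (Sum.elim (Sum.elim Sum.inl
    (fun j => Sum.inr (e (Sum.inl j)))) (fun j => Sum.inr (e (Sum.inr j))))
  have key : ∀ x : Fin n → N, (ψ.Realize (Sum.elim x (fun i => (c i : N))) ↔ Sum.elim x a ∈ X) := by
    intro x
    rw [hφ, Formula.realize_relabel]
    apply iff_of_eq
    congr 1
    ext j
    rcases j with (j | j) | j <;> simp [c]
  rw [← key]
  exact hb ⟨⟨p', ψ, c⟩, hU.mono fun x hx => (key x).2 hx⟩

lemma sat_lemma (hsat : IsSaturated L (Order.succ (Cardinal.mk M)) N) {γ β : Type} [Finite γ]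
    [Finite β] (U : Ultrafilter (γ → N)) (a : β → N) :
    ∃ b : γ → N, ∀ X : Set (γ ⊕ β → N), (M : Set N).Definable L X →
      (∀ᶠ x in (U : Filter (γ → N)), Sum.elim x a ∈ X) → Sum.elim b a ∈ X := by
  obtain ⟨n, ⟨e⟩⟩ := Finite.exists_equiv_fin γ
  obtain ⟨b, hb⟩ := sat_fin hsat (U.map fun x => x ∘ e.symm) a
  refine ⟨b ∘ e, fun X hX hU => ?_⟩
  have e1 : ∀ x : Fin n → N, (Sum.elim x a ∘ Sum.map e id : γ ⊕ β → N) = Sum.elim (x ∘ e) a := by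
    intro x; ext i; rcases i with i | i <;> rfl
  have h1 := hb _ (definable_reindex (Sum.map e id) hX) (by
    change ∀ᶠ x in (U : Filter (γ → N)), _ ∈ X
    filter_upwards [hU] with x hx
    rw [e1]
    convert hx using 2
    ext i; simp)
  rw [Set.mem_ofPred_eq, e1] at h1
  exact h1

lemma exists_seq (hsat : IsSaturated L (Order.succ (Cardinal.mk M)) N) {ξ : Type} [Finite ξ]
    (U : Ultrafilter (ξ → N)) : ∃ b : ℕ → ξ → N, ∀ (n : ℕ) (X : Set (ξ ⊕ (Fin n × ξ) → N)),
      (M : Set N).Definable L X →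
      (∀ᶠ x in (U : Filter (ξ → N)), Sum.elim x (fun z : Fin n × ξ => b z.1 z.2) ∈ X) →
      Sum.elim (b n) (fun z : Fin n × ξ => b z.1 z.2) ∈ X := by
  have h1 := fun (n : ℕ) (a : Fin n × ξ → N) => sat_lemma hsat U a
  choose next hnext using h1
  let b : ℕ → ξ → N := Nat.lt_wfRel.wf.fix
    (fun n ih => next n (fun z => ih z.1 z.1.2 z.2))
  have hb : ∀ n, b n = next n (fun z => b z.1 z.2) := by
    intro n
    exact Nat.lt_wfRel.wf.fix_eq _ n
  refine ⟨b, fun n X hX h => ?_⟩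
  rw [hb n]
  exact hnext n _ X hX h

/-- iff version of realization -/
lemma seq_iff {ξ : Type} {U : Ultrafilter (ξ → N)} {b : ℕ → ξ → N}
    (hb : ∀ (n : ℕ) (X : Set (ξ ⊕ (Fin n × ξ) → N)), (M : Set N).Definable L X →
      (∀ᶠ x in (U : Filter (ξ → N)), Sum.elim x (fun z : Fin n × ξ => b z.1 z.2) ∈ X) →
      Sum.elim (b n) (fun z : Fin n × ξ => b z.1 z.2) ∈ X)
    (n : ℕ) {γ : Type} (f : γ → ℕ × ξ) (hf : ∀ i, (f i).1 < n)
    {X : Set (ξ ⊕ γ → N)} (hX : (M : Set N).Definable L X) :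
    Sum.elim (b n) (fun i => b (f i).1 (f i).2) ∈ X ↔
      ∀ᶠ x in (U : Filter (ξ → N)), Sum.elim x (fun i => b (f i).1 (f i).2) ∈ X := by
  have main : ∀ {X : Set (ξ ⊕ γ → N)}, (M : Set N).Definable L X →
      (∀ᶠ x in (U : Filter (ξ → N)), Sum.elim x (fun i => b (f i).1 (f i).2) ∈ X) → 
      Sum.elim (b n) (fun i => b (f i).1 (f i).2) ∈ X := by
    intro X hX h
    have h1 := hb n _ (definable_reindex (Sum.map id (fun i => (⟨(f i).1, hf i⟩, (f i).2))) hX)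
    simp only [Set.mem_ofPred_eq, elim_comp_map] at h1
    exact h1 h
  refine ⟨fun h => ?_, main hX⟩
  by_contra h2
  rw [← Ultrafilter.eventually_not] at h2
  exact main hX.compl h2 h

lemma seq_indisc {ξ : Type} [Finite ξ] {U : Ultrafilter (ξ → N)} {b : ℕ → ξ → N}
    (hinv : ∀ (γ : Type) [Finite γ] (X : Set (ξ ⊕ γ → N)), (M : Set N).Definable L X →
        ∀ c c' : γ → N, Eqv M c c' →
        ∀ᶠ x in (U : Filter (ξ → N)), (Sum.elim x c ∈ X ↔ Sum.elim x c' ∈ X))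
    (hb : ∀ (n : ℕ) (X : Set (ξ ⊕ (Fin n × ξ) → N)), (M : Set N).Definable L X →
      (∀ᶠ x in (U : Filter (ξ → N)), Sum.elim x (fun z : Fin n × ξ => b z.1 z.2) ∈ X) →
      Sum.elim (b n) (fun z : Fin n × ξ => b z.1 z.2) ∈ X) (m : ℕ) :
    ∀ (i j : Fin m → ℕ), StrictMono i → StrictMono j →
    Eqv M (fun q : Fin m × ξ => b (i q.1) q.2) (fun q : Fin m × ξ => b (j q.1) q.2) := by
  induction m with
  | zero =>
    intro i j _ _ Y hY h
    convert h using 1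
    ext z
    exact z.1.elim0
  | succ m ih =>
    intro i j hi hj Y hY h
    have h1 := ih (i ∘ Fin.castSucc) (j ∘ Fin.castSucc) (hi.comp Fin.strictMono_castSucc)
      (hj.comp Fin.strictMono_castSucc)
    let σ : Fin (m + 1) × ξ → ξ ⊕ (Fin m × ξ) := fun z =>
      Fin.lastCases (motive := fun _ => ξ ⊕ (Fin m × ξ)) (Sum.inl z.2)
        (fun k => Sum.inr (k, z.2)) z.1
    have e1 : ∀ i : Fin (m + 1) → ℕ, (Sum.elim (b (i (Fin.last m)))
        (fun z : Fin m × ξ => b (i z.1.castSucc) z.2) ∘ σ) = fun z => b (i z.1) z.2 := by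
      intro i
      ext ⟨k, z⟩
      induction k using Fin.lastCases with
      | last => simp [σ]
      | cast k => simp [σ]
    have hX := definable_reindex σ hY
    rw [← e1 i] at h
    rw [← e1 j]
    have h2 := (seq_iff hb (i (Fin.last m)) (fun z : Fin m × ξ => (i z.1.castSucc, z.2))
      (fun z => hi (Fin.castSucc_lt_last _)) hX).1 h
    refine (seq_iff hb (j (Fin.last m)) (fun z : Fin m × ξ => (j z.1.castSucc, z.2))
      (fun z => hj (Fin.castSucc_lt_last _)) hX).2 ?_
    filter_upwards [h2, hinv _ _ hX _ _ h1] with x hx1 hx2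
    exact hx2.1 hx1


lemma exists_ulift_equiv (K : Type w) [L.Structure K] :
    ∃ (F : Type max u v w) (_ : L.Structure F), Nonempty (K ≃[L] F) := by
  let _ : L.Structure (ULift.{max u v} K) := Equiv.ulift.symm.inducedStructure
  exact ⟨ULift.{max u v} K, inferInstance,
    ⟨Equiv.inducedStructureEquiv (L := L) (Equiv.ulift.{max u v} (α := K)).symm⟩⟩

lemma definable_mixed {τ α : Type*} (φ : L.Formula τ) (s : τ → α ⊕ M) :
    (M : Set N).Definable L {g : α → N | φ.Realize (fun t => Sum.elim g (fun m : M => (m : N)) (s t))} := by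
  have h := definable_section (M := M) (definable_formula (M := M) (φ.relabel s)) (id : M → M)
  convert h using 1
  ext g
  simp only [Set.mem_ofPred_eq, Formula.realize_relabel]
  rfl

/-- realizing an ultrafilter in an ultrapower -/
lemma exists_real {ξ : Type} (q : ξ → N) (U : Ultrafilter (ξ → N)) :
    ∃ (F : Type max u v w) (_ : L.Structure F) (G : N ↪ₑ[L] F) (a' : ξ → F),
      ∀ (γ : Type) (φ : L.Formula (ξ ⊕ γ)) (c : γ → N),
        φ.Realize (Sum.elim a' (G ∘ c)) ↔
          ∀ᶠ x in (U : Filter (ξ → N)), φ.Realize (Sum.elim x c) := by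
  rcases isEmpty_or_nonempty N with hN | hN
  · obtain ⟨F, hF, ⟨G⟩⟩ := exists_ulift_emb (L := L) N
    refine ⟨F, hF, G, G ∘ q, fun γ φ c => ?_⟩
    have hξ : IsEmpty ξ := ⟨fun i => hN.false (q i)⟩
    have h1 : ∀ x : ξ → N, x = q := fun x => Subsingleton.elim _ _
    rw [← Sum.comp_elim, G.map_formula]
    constructor
    · intro h
      exact Eventually.of_forall fun x => by rw [h1 x]; exact h
    · intro h
      obtain ⟨x, hx⟩ := h.exists
      rwa [h1 x] at hx
  · obtain ⟨F, hF, G, germ, hG, hgerm⟩ := exists_ultra (L := L) (N := N) U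
    refine ⟨F, hF, G, fun i => germ fun x => x i, fun γ φ c => ?_⟩
    have h1 := hgerm _ φ (Sum.elim (fun i x => x i) (fun i _ => c i))
    refine Iff.trans (iff_of_eq ?_) (h1.trans (eventually_congr (Eventually.of_forall ?_)))
    · congr 1
      ext i; rcases i with i | i
      · rfl
      · exact hG _
    · intro x
      apply iff_of_eq
      congr 1
      ext i; rcases i with i | i <;> rfl

lemma SameTypeOver.fin {K : Type*} [L.Structure K] {A : Set K} {γ β : Type*} [Finite β]
    {b b' : γ → K} (h : SameTypeOver L A b b') (φ : L.Formula (γ ⊕ β)) (m : β → K)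
    (hm : ∀ i, m i ∈ A) :
    φ.Realize (Sum.elim b m) ↔ φ.Realize (Sum.elim b' m) := by
  obtain ⟨p, ⟨e⟩⟩ := Finite.exists_equiv_fin β
  have h1 := h p (φ.relabel (Sum.map id e)) (m ∘ e.symm) (fun i => hm _)
  have e1 : ∀ b : γ → K, (Sum.elim b (m ∘ e.symm) ∘ Sum.map id e : γ ⊕ β → K) = Sum.elim b m := by
    intro b; ext i; rcases i with i | i <;> simp
  rw [Formula.realize_relabel, Formula.realize_relabel, e1, e1] at h1
  exact h1

lemma indisc_same {K : Type*} [L.Structure K] {A : Set K} {γ : Type*} {c : ℕ → γ → K}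
    (h : IsIndiscernibleOver L A c) (n n' : ℕ) : SameTypeOver L A (c n) (c n') := by
  intro p φ m hm
  have h1 := h 1 (fun _ => n) (fun _ => n') (Subsingleton.strictMono _) (Subsingleton.strictMono _)
    p (φ.relabel (Sum.map (fun i => (0, i)) id)) m hm
  have e1 : ∀ n : ℕ, (Sum.elim (fun q : Fin 1 × γ => c n q.2) m ∘ Sum.map (fun i => (0, i)) id :
      γ ⊕ Fin p → K) = Sum.elim (c n) m := by
    intro b; ext i; rcases i with i | i <;> simp
  rw [Formula.realize_relabel, Formula.realize_relabel, e1, e1] at h1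
  exact h1

/-- A formula realized by a tuple of `A` does not fork over `A`. -/
lemma not_forks_of_point {K : Type w} [L.Structure K] {A : Set K} {β γ : Type} [Finite β]
    (φ : L.Formula (β ⊕ γ)) (c : γ → K) (m : β → K) (hm : ∀ i, m i ∈ A)
    (h : φ.Realize (Sum.elim m c)) : ¬ Forks L A φ c := by
  rintro ⟨E, k, n, ψ, cs, hdiv, himp⟩
  obtain ⟨i, hi⟩ := himp (E.emb ∘ m) (by
    rw [← Sum.comp_elim]
    exact (E.emb.map_formula φ _).2 h)
  obtain ⟨E', d, hd, hsame, hcon⟩ := hdiv i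
  apply hcon
  intro s
  refine ⟨E'.emb ∘ E.emb ∘ m, fun j _ => ?_⟩
  have hmA : ∀ z, (E'.emb ∘ E.emb ∘ m) z ∈ E'.emb '' (E.emb '' A) :=
    fun z => ⟨_, ⟨_, hm z, rfl⟩, rfl⟩
  have sw : ∀ y : Fin n → E'.Carrier, ((ψ i).relabel Sum.swap).Realize
      (Sum.elim y (E'.emb ∘ E.emb ∘ m)) ↔ (ψ i).Realize (Sum.elim (E'.emb ∘ E.emb ∘ m) y) := by
    intro y
    rw [Formula.realize_relabel]
    apply iff_of_eq
    congr 1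
    ext z; rcases z with z | z <;> rfl
  rw [← sw, (indisc_same hd j 0).fin _ _ hmA, hsame.fin _ _ hmA, sw, ← Sum.comp_elim]
  exact (E'.emb.map_formula (ψ i) _).2 hi

/-- pulling tuples of an elementary extension into the saturated model -/
lemma pull (hsat : IsSaturated L (Order.succ (Cardinal.mk M)) N) {E : Type*} [L.Structure E]
    (g : N ↪ₑ[L] E) {γ β : Type} [Finite γ] [Finite β] (e : γ → E) (a : β → N) :
    ∃ b : γ → N, 
      (∀ χ : L.Formula (γ ⊕ β), χ.Realize (Sum.elim e (g ∘ a)) ↔ χ.Realize (Sum.elim b a)) ∧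
      ∀ (p : ℕ) (φ : L.Formula (γ ⊕ Fin p)) (m : Fin p → M), 
        φ.Realize (Sum.elim e (g ∘ tup M m)) ↔ φ.Realize (Sum.elim b (tup M m)) := by
  let par : β ⊕ M → N := Sum.elim a (fun m => (m : N))
  let F : Filter (γ → N) :=
    { sets := {A | ∃ φ : L.Formula ((β ⊕ M) ⊕ γ), φ.Realize (Sum.elim (g ∘ par) e) ∧
        ∀ x, φ.Realize (Sum.elim par x) → x ∈ A}
      univ_sets := ⟨⊤, by simp [Formula.realize_top], fun _ _ => trivial⟩
      sets_of_superset := by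
        rintro A B ⟨Y, h1, h2⟩ hAB
        exact ⟨Y, h1, fun m hm => hAB (h2 m hm)⟩
      inter_sets := by
        rintro A B ⟨Y, h1, h2⟩ ⟨Y', h1', h2'⟩
        refine ⟨Y ⊓ Y', Formula.realize_inf.2 ⟨h1, h1'⟩, fun m hm => ?_⟩
        rw [Formula.realize_inf] at hm
        exact ⟨h2 m hm.1, h2' m hm.2⟩ }
  have hF : NeBot F := by
    rw [neBot_iff, ne_eq, ← empty_mem_iff_bot]
    rintro ⟨φ, h1, h2⟩
    have h3 : (φ.iExs γ).Realize (g ∘ par) := Formula.realize_iExs.2 ⟨e, h1⟩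
    rw [g.map_formula] at h3
    obtain ⟨x, hx⟩ := Formula.realize_iExs.1 h3
    exact h2 x hx
  obtain ⟨b, hb⟩ := sat_lemma hsat (Ultrafilter.of F) a
  have main : ∀ (τ : Type) (φ : L.Formula τ) (s : τ → (γ ⊕ β) ⊕ M),
      φ.Realize (fun t => Sum.elim (Sum.elim e (g ∘ a)) (fun m : M => g m) (s t)) →
      φ.Realize (fun t => Sum.elim (Sum.elim b a) (fun m : M => (m : N)) (s t)) := by
    intro τ φ s h
    refine hb _ (definable_mixed φ s) (Ultrafilter.of_le F ?_)
    let ρ : (γ ⊕ β) ⊕ M → (β ⊕ M) ⊕ γ := Sum.elim (Sum.elim Sum.inr (fun i => Sum.inl (Sum.inl i)))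
      (fun m => Sum.inl (Sum.inr m))
    refine ⟨φ.relabel (ρ ∘ s), ?_, ?_⟩
    · rw [Formula.realize_relabel]
      convert h using 1
      ext t
      simp only [Function.comp_apply]
      rcases s t with (i | i) | i <;> rfl
    · intro x hx
      rw [Formula.realize_relabel] at hx
      change φ.Realize _
      convert hx using 1
      ext t
      simp only [Function.comp_apply]
      rcases s t with (i | i) | i <;> rfl
  have main2 : ∀ (τ : Type) (φ : L.Formula τ) (s : τ → (γ ⊕ β) ⊕ M),
      φ.Realize (fun t => Sum.elim (Sum.elim e (g ∘ a)) (fun m : M => g m) (s t)) ↔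
      φ.Realize (fun t => Sum.elim (Sum.elim b a) (fun m : M => (m : N)) (s t)) := by
    intro τ φ s
    refine ⟨main τ φ s, fun h => ?_⟩
    by_contra h2
    have h3 := main τ φ.not s (by rwa [Formula.realize_not])
    rw [Formula.realize_not] at h3
    exact h3 h
  refine ⟨b, fun χ => main2 _ χ Sum.inl, fun p φ m => ?_⟩
  have h1 := main2 _ φ (Sum.elim (fun i => Sum.inl (Sum.inl i)) (fun i => Sum.inr (m i)))
  convert h1 using 2
  · ext t; rcases t with t | t <;> rfl
  · ext t; rcases t with t | t <;> rfl

lemma SameTypeOver.trans' {K : Type*} [L.Structure K] {A : Set K} {γ : Type*}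
    {b b' b'' : γ → K} (h : SameTypeOver L A b b') (h' : SameTypeOver L A b' b'') :
    SameTypeOver L A b b'' :=
  fun p φ m hm => (h p φ m hm).trans (h' p φ m hm)



lemma nf_ext (hsat : IsSaturated L (Order.succ (Cardinal.mk M)) N) {ξ : Type} [Finite ξ]
    {U : Ultrafilter (ξ → N)}
    (hinv : ∀ (γ : Type) [Finite γ] (X : Set (ξ ⊕ γ → N)), (M : Set N).Definable L X →
        ∀ c c' : γ → N, Eqv M c c' →
        ∀ᶠ x in (U : Filter (ξ → N)), (Sum.elim x c ∈ X ↔ Sum.elim x c' ∈ X))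
    {F : Type max u v w} [L.Structure F] (G : N ↪ₑ[L] F) (a' : ξ → F)
    (hreal : ∀ (γ : Type) (φ : L.Formula (ξ ⊕ γ)) (c : γ → N),
        φ.Realize (Sum.elim a' (G ∘ c)) ↔
          ∀ᶠ x in (U : Filter (ξ → N)), φ.Realize (Sum.elim x c)) :
    TypeDoesNotForkOver L (G '' (M : Set N)) (Set.range G) a' := by
  intro p φ c hc hφ
  choose c0 hc0 using hc
  obtain rfl : G ∘ c0 = c := funext hc0
  rw [hreal] at hφ
  rintro ⟨E', k, m, ψ, cs, hdiv, himp⟩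
  let g' : N ↪ₑ[L] E'.Carrier := E'.emb.comp G
  obtain ⟨b, hb1, hb2⟩ := pull hsat g' (fun z : Fin k × Fin m => cs z.1 z.2) c0
  have hN : ∀ x : ξ → N, φ.Realize (Sum.elim x c0) →
      ∃ i, (ψ i).Realize (Sum.elim x (fun j => b (i, j))) := by
    let θ : L.Formula (((Fin k × Fin m) ⊕ Fin p) ⊕ ξ) :=
      (φ.relabel (Sum.elim Sum.inr (fun j => Sum.inl (Sum.inr j)))).imp
        (Formula.iSup fun i : Fin k =>
          (ψ i).relabel (Sum.elim Sum.inr (fun j => Sum.inl (Sum.inl (i, j)))))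
    have hθ : ∀ (K : Type max u v w) [L.Structure K] (e : Fin k × Fin m → K) (a : Fin p → K) (x : ξ → K),
        θ.Realize (Sum.elim (Sum.elim e a) x) ↔ (φ.Realize (Sum.elim x a) →
          ∃ i, (ψ i).Realize (Sum.elim x (fun j => e (i, j)))) := by
      intro K _ e a x
      simp only [θ, Formula.realize_imp, Formula.realize_iSup, Formula.realize_relabel,
        Sum.comp_elim]
      rfl
    have hθ' : ∀ (e : Fin k × Fin m → N) (a : Fin p → N) (x : ξ → N),
        θ.Realize (Sum.elim (Sum.elim e a) x) ↔ (φ.Realize (Sum.elim x a) →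
          ∃ i, (ψ i).Realize (Sum.elim x (fun j => e (i, j)))) := by
      intro e a x
      simp only [θ, Formula.realize_imp, Formula.realize_iSup, Formula.realize_relabel,
        Sum.comp_elim]
      rfl
    have h1 := (hb1 (θ.iAlls ξ)).1 (Formula.realize_iAlls.2 fun x => by
      rw [hθ]
      exact himp x)
    intro x
    rw [← hθ']
    exact Formula.realize_iAlls.1 h1 x
  have hi : ∃ i, ∀ᶠ x in (U : Filter (ξ → N)), (ψ i).Realize (Sum.elim x (fun j => b (i, j))) := by
    by_contra hno
    push Not at hno
    have h1 : ∀ i, ∀ᶠ x in (U : Filter (ξ → N)), ¬ (ψ i).Realize (Sum.elim x (fun j => b (i, j))) :=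
      fun i => hno i
    obtain ⟨x, hx1, hx2⟩ := (hφ.and (eventually_all.2 h1)).exists
    obtain ⟨i, hi⟩ := hN x hx1
    exact hx2 i hi
  obtain ⟨i, hi⟩ := hi
  obtain ⟨E'', d, hd, hsame, hcon⟩ := hdiv i
  apply hcon
  intro s
  by_contra hs
  push Not at hs
  let g'' : N ↪ₑ[L] E''.Carrier := E''.emb.comp g'
  obtain ⟨d0, hd1, hd2⟩ := pull hsat g'' (fun z : s × Fin m => d z.1 z.2) (Empty.elim : Empty → N)
  have hN2 : ∀ x : ξ → N, ∃ n : s, ¬ (ψ i).Realize (Sum.elim x (fun j => d0 (n, j))) := by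
    let θ : L.Formula (((s × Fin m) ⊕ Empty) ⊕ ξ) :=
        (Formula.iSup fun n : s =>
          ((ψ i).relabel (Sum.elim Sum.inr (fun j => Sum.inl (Sum.inl (n, j))))).not)
    have h1 := (hd1 (θ.iAlls ξ)).1 (Formula.realize_iAlls.2 fun x => by
      simp only [θ, Formula.realize_not, Formula.realize_iSup, Formula.realize_relabel,
        Sum.comp_elim]
      obtain ⟨n, hn, h⟩ := hs x
      exact ⟨⟨n, hn⟩, h⟩)
    intro x
    have h2 := Formula.realize_iAlls.1 h1 x
    simp only [θ, Formula.realize_not, Formula.realize_iSup, Formula.realize_relabel,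
        Sum.comp_elim] at h2
    exact h2
  have heqv : ∀ n : s, Eqv M (fun j => d0 (n, j)) (fun j => b (i, j)) := by
    intro n Y hY h1
    obtain ⟨r, χ, mm, hχ⟩ := definable_param hY
    rw [hχ] at h1 ⊢
    have h2 := hd2 r (χ.relabel (Sum.map (fun j => (n, j)) id)) mm
    have h3 := hb2 r (χ.relabel (Sum.map (fun j => (i, j)) id)) mm
    simp only [Formula.realize_relabel, Sum.elim_comp_map, Function.comp_id] at h2 h3
    have hmm : ∀ z, (E''.emb ∘ E'.emb ∘ G ∘ tup M mm) z ∈ E''.emb '' (E'.emb '' (G '' (M : Set N))) :=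
      fun z => ⟨_, ⟨_, ⟨_, tup_mem mm z, rfl⟩, rfl⟩, rfl⟩
    refine h3.1 ?_
    have h4 := h2.2 h1
    have h5 := ((indisc_same hd n 0).trans' hsame r χ _ hmm).1 h4
    rw [← Sum.comp_elim, E''.emb.map_formula] at h5
    exact h5
  have hall : ∀ n : s, ∀ᶠ x in (U : Filter (ξ → N)), (ψ i).Realize (Sum.elim x (fun j => d0 (n, j))) := by
    intro n
    have h1 := hinv _ _ (definable_formula (M := M) (ψ i)) _ _ (heqv n)
    filter_upwards [h1, hi] with x hx1 hx2
    exact hx1.2 hx2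
  obtain ⟨x, hx⟩ := (eventually_all.2 hall).exists
  obtain ⟨n, hn⟩ := hN2 x
  exact hn (hx n)

lemma nf_heir {ξ : Type} [Finite ξ] (q : ξ → N)
    {U : Ultrafilter (ξ → N)}
    (heir : ∀ (κ : Type) [Finite κ] (X : Set (ξ ⊕ κ → N)), (M : Set N).Definable L X →
        (∀ m : κ → M, Sum.elim q (tup M m) ∈ X) → ∀ d : κ → N,
        ∀ᶠ x in (U : Filter (ξ → N)), Sum.elim x d ∈ X)
    {F : Type max u v w} [L.Structure F] (G : N ↪ₑ[L] F) (a' : ξ → F)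
    (hreal : ∀ (γ : Type) (φ : L.Formula (ξ ⊕ γ)) (c : γ → N),
        φ.Realize (Sum.elim a' (G ∘ c)) ↔
          ∀ᶠ x in (U : Filter (ξ → N)), φ.Realize (Sum.elim x c))
    {β : Type} [Finite β] (bs : β → N) :
    TypeDoesNotForkOver L (G '' (M : Set N)) (G '' (M : Set N) ∪ Set.range a') (G ∘ bs) := by
  intro p φ c hc hφ
  have hc' : ∀ i, ∃ s : ξ ⊕ M, c i = Sum.elim a' (fun m : M => G m) s := by
    intro i
    rcases hc i with ⟨m, hm, h⟩ | ⟨j, h⟩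
    · exact ⟨Sum.inr ⟨m, hm⟩, h.symm⟩
    · exact ⟨Sum.inl j, h.symm⟩
  choose s hs using hc'
  let ρ : β ⊕ Fin p → (ξ ⊕ β) ⊕ M := Sum.elim (fun i => Sum.inl (Sum.inr i))
    (fun i => Sum.elim (fun j => Sum.inl (Sum.inl j)) Sum.inr (s i))
  have hX := definable_mixed (M := M) φ ρ
  set X : Set (ξ ⊕ β → N) := 
    {g | φ.Realize (fun t => Sum.elim g (fun m : M => (m : N)) (ρ t))} with hXdef
  have key : ∀ y : β → N, φ.Realize (Sum.elim (G ∘ y) c) ↔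
      ∀ᶠ x in (U : Filter (ξ → N)), Sum.elim x y ∈ X := by
    intro y
    let ρ' : β ⊕ Fin p → ξ ⊕ (β ⊕ Fin p) := Sum.elim (fun i => Sum.inr (Sum.inl i))
      (fun i => Sum.elim (fun j => Sum.inl j) (fun _ => Sum.inr (Sum.inr i)) (s i))
    rcases isEmpty_or_nonempty N with hN | hN
    · have e1 : ∀ x : ξ → N, (fun t => Sum.elim (Sum.elim x y) (fun m : M => (m : N)) (ρ t)) =
          fun t => Sum.elim (Sum.elim x y) (fun m : M => (m : N)) (ρ t) := fun _ => rfl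
      have h1 := hreal _ (φ.relabel (fun t : β ⊕ Fin p => Sum.elim (fun i : β => Sum.inr i)
        (fun i => Sum.elim Sum.inl (fun m : M => (hN.false (m : N)).elim) (s i)) t : β ⊕ Fin p → ξ ⊕ β)) y
      simp only [Formula.realize_relabel] at h1
      refine Iff.trans (iff_of_eq ?_) (h1.trans (eventually_congr (Eventually.of_forall fun x => iff_of_eq ?_)))
      · congr 1
        ext t; rcases t with t | t
        · rfl
        · simp only [Sum.elim_inr, Function.comp_apply, hs]
          rcases s t with j | j
          · rfl
          · exact (hN.false (j : N)).elim
      · change φ.Realize _ = φ.Realize _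
        congr 1
        ext t; rcases t with t | t
        · rfl
        · simp only [ρ, Sum.elim_inr, Function.comp_apply]
          rcases s t with j | j
          · rfl
          · exact (hN.false (j : N)).elim
    · have h1 := hreal _ (φ.relabel ρ') (Sum.elim y
        (fun i => Sum.elim (fun _ => Classical.arbitrary N) (fun m : M => (m : N)) (s i)))
      simp only [Formula.realize_relabel] at h1
      refine Iff.trans (iff_of_eq ?_) (h1.trans (eventually_congr (Eventually.of_forall fun x => iff_of_eq ?_)))
      · congr 1
        ext t; rcases t with t | t
        · rfl
        · simp only [ρ', Sum.elim_inr, Function.comp_apply, hs]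
          rcases hst : s t with j | j
          · rfl
          · simp [hst]
      · change φ.Realize _ = φ.Realize _
        congr 1
        ext t; rcases t with t | t
        · rfl
        · simp only [ρ, ρ', Sum.elim_inr, Function.comp_apply]
          rcases hst : s t with j | j
          · rfl
          · simp [hst]
  rw [key] at hφ
  have hm : ∃ m : β → M, Sum.elim q (tup M m) ∈ X := by
    by_contra hno
    push Not at hno
    have h1 := heir _ Xᶜ hX.compl hno bs
    obtain ⟨x, hx1, hx2⟩ := (hφ.and h1).exists
    exact hx2 hx1
  obtain ⟨m, hm⟩ := hm
  refine not_forks_of_point φ c (G ∘ tup M m) (fun i => ⟨_, tup_mem m i, rfl⟩) ((key _).2 ?_)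
  have h1 := heir Empty {g | Sum.elim (g ∘ Sum.inl) (tup M m) ∈ X} ?_ ?_ Empty.elim
  · exact h1
  · exact definable_reindex (M := M) (Sum.inl : ξ → ξ ⊕ Empty) (definable_section (M := M) hX m)
  · intro m'
    exact hm

lemma same_ext {ξ : Type} [Finite ξ]
    {U : Ultrafilter (ξ → N)} {b : ℕ → ξ → N}
    (hb : ∀ (n : ℕ) (X : Set (ξ ⊕ (Fin n × ξ) → N)), (M : Set N).Definable L X →
      (∀ᶠ x in (U : Filter (ξ → N)), Sum.elim x (fun z : Fin n × ξ => b z.1 z.2) ∈ X) →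
      Sum.elim (b n) (fun z : Fin n × ξ => b z.1 z.2) ∈ X)
    {F : Type max u v w} [L.Structure F] (G : N ↪ₑ[L] F) (a' : ξ → F)
    (hreal : ∀ (γ : Type) (φ : L.Formula (ξ ⊕ γ)) (c : γ → N),
        φ.Realize (Sum.elim a' (G ∘ c)) ↔
          ∀ᶠ x in (U : Filter (ξ → N)), φ.Realize (Sum.elim x c)) (n : ℕ) :
    SameTypeOver L (G '' ((M : Set N) ∪ Set.range (fun z : Fin n × ξ => b z.1 z.2)))
      a' (G ∘ b n) := by
  intro p φ m hm
  choose m0 hm0 hm1 using hm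
  obtain rfl : G ∘ m0 = m := funext hm1
  have hc' : ∀ i, ∃ s : (Fin n × ξ) ⊕ M,
      m0 i = Sum.elim (fun z : Fin n × ξ => b z.1 z.2) (fun m : M => (m : N)) s := by
    intro i
    rcases hm0 i with h | ⟨j, h⟩
    · exact ⟨Sum.inr ⟨_, h⟩, rfl⟩
    · exact ⟨Sum.inl j, h.symm⟩
  choose s hs using hc'
  let ρ : ξ ⊕ Fin p → (ξ ⊕ (Fin n × ξ)) ⊕ M := Sum.elim (fun i => Sum.inl (Sum.inl i))
    (fun i => Sum.elim (fun j => Sum.inl (Sum.inr j)) Sum.inr (s i))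
  have h1 := seq_iff hb n (fun z : Fin n × ξ => (((z.1 : ℕ), z.2) : ℕ × ξ)) (fun z => z.1.2)
    (definable_mixed (M := M) φ ρ)
  have e1 : ∀ x : ξ → N, (fun t => Sum.elim (Sum.elim x (fun z : Fin n × ξ => b z.1 z.2))
      (fun m : M => (m : N)) (ρ t)) = Sum.elim x m0 := by
    intro x
    ext t; rcases t with t | t
    · rfl
    · simp only [ρ, Sum.elim_inr, hs]
      rcases s t with j | j <;> rfl
  simp only [Set.mem_ofPred_eq, e1] at h1
  rw [hreal, ← h1, ← Sum.comp_elim, G.map_formula]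

lemma strict_ext (A : Set N) {ξ β : Type} (a : ξ → N) (bs : β → N)
    {F : Type max u v w} [L.Structure F] (G : N ↪ₑ[L] F) (a' : ξ → F)
    (h1 : SameTypeOver L (G '' (A ∪ Set.range bs)) a' (G ∘ a))
    (h2 : TypeDoesNotForkOver L (G '' A) (Set.range G) a')
    (h3 : TypeDoesNotForkOver L (G '' A) (G '' A ∪ Set.range a') (G ∘ bs)) :
    StrictlyNonForkingOver L A a bs := by
  obtain ⟨K, hK, ⟨e⟩⟩ := exists_ulift_equiv (L := L) N
  have e1 : (⇑(G.comp e.symm.toElementaryEmbedding) ∘ ⇑e.toElementaryEmbedding : N → F) = G := by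
    ext x
    change G (e.symm (e x)) = G x
    rw [e.symm_apply_apply]
  have e2 : Set.range ⇑(G.comp e.symm.toElementaryEmbedding) = Set.range G := by
    change Set.range (G ∘ e.symm) = _
    exact e.symm.surjective.range_comp _
  refine ⟨⟨K, e.toElementaryEmbedding⟩, ⟨F, G.comp e.symm.toElementaryEmbedding⟩, a', ?_, ?_, ?_⟩
  · rw [← Function.comp_assoc]
    simp only [e1]
    exact h1
  · simp only [e1, e2]
    exact h2
  · rw [← Function.comp_assoc]
    simp only [e1]
    exact h3

theorem exists_strict (hNIP : IsNIP L N)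
    (hsat : IsSaturated L (Order.succ (Cardinal.mk M)) N)
    (ny : ℕ) (q : Fin ny → N) :
    ∃ b : ℕ → Fin ny → N, IsStrictMorleySequence L (M : Set N) q b := by
  obtain ⟨U, heir, hinv⟩ := exists_type (M := M) hNIP q
  obtain ⟨b, hb⟩ := exists_seq hsat U
  obtain ⟨F, hF, G, a', hreal⟩ := exists_real (L := L) q U
  refine ⟨b, fun m i j hi hj => (seq_indisc hinv hb m i j hi hj).sameType, fun n => ?_, fun n => ?_⟩
  · apply Eqv.sameType
    apply Eqv.symm
    intro Y hY hq
    have hY' := definable_reindex (M := M) (Sum.inl : Fin ny → Fin ny ⊕ Empty) hY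
    have h1 := heir Empty _ hY' (fun m => hq) Empty.elim
    have h2 := (seq_iff hb n (Empty.elim : Empty → ℕ × Fin ny) (fun i => i.elim) hY').2 
      (by filter_upwards [h1] with x hx using hx)
    exact h2
  · exact strict_ext (M : Set N) (b (n + 1)) _ G a' (same_ext hb G a' hreal (n + 1))
      (nf_ext hsat hinv G a' hreal) (nf_heir q heir G a' hreal _)

end Proof

/-- Fact 2.6 of the paper, due to Chernikov–Kaplan. Let `M ⪯ N` be models
of a complete NIP theory with `N` sufficiently saturated (`|M|⁺`-saturated). Let `q(y)` be
a complete type over `M` (encoded by a realization `q` in `N`; all such types are realized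
in `N` by saturation). Then there exists a strict Morley sequence `b` in `N` for `q(y)`. -/
theorem statement5 {L : FirstOrder.Language.{u, v}} {N : Type w} [L.Structure N]
    (M : L.ElementarySubstructure N) (hNIP : IsNIP L N)
    (hsat : IsSaturated L (Order.succ (Cardinal.mk M)) N)
    (ny : ℕ) (q : Fin ny → N) :
    ∃ b : ℕ → Fin ny → N, IsStrictMorleySequence L (M : Set N) q b := by
  exact exists_strict hNIP hsat ny q

end DistalPaper
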